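/- arXiv:1803.00910 — 6 statements merged into one kernel-verified Lean document; each statement's English description precedes it below -/
import Mathlib

section
/- Let Q, Q̃ : [0,1] → ℝ be continuous functions and let (μ_k)_{k≥1} be a sequence of distinct positive real numbers such that the series Σ_{k≥1} 1/√(μ_k) diverges. If D_Q(μ_k)·Δ_{Q̃}(μ_k) = D_{Q̃}(μ_k)·Δ_Q(μ_k) for every k ≥ 1, then D_Q(μ)·Δ_{Q̃}(μ) = D_{Q̃}(μ)·Δ_Q(μ) for all μ ∈ ℂ (equivalently, the Weyl–Titchmarsh functions M_Q = -D_Q/Δ_Q and M_{Q̃} = -D_{Q̃}/Δ_{Q̃} coincide as meromorphic functions). -/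
open Set

/-- `v` (with derivative `v'`) is a solution of the Schrödinger equation
`-v'' + Q v = -μ v`, i.e. `v'' = (Q + μ) v`, on `[0,1]`. -/
def IsSol (Q : ℝ → ℝ) (μ : ℂ) (v v' : ℝ → ℂ) : Prop :=
  (∀ x ∈ Icc (0:ℝ) 1, HasDerivWithinAt v (v' x) (Icc (0:ℝ) 1) x) ∧
  (∀ x ∈ Icc (0:ℝ) 1, HasDerivWithinAt v' ((↑(Q x) + μ) * v x) (Icc (0:ℝ) 1) x)

open Filter Topology Asymptotics Bornology

/-- Dividing out the half-plane Blaschke factor `(z - a) / (z + a)` of a zero `a > 0` preserves the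
bound of an entire function on the closed right half-plane. -/
theorem exists_blaschke_quotient {g : ℂ → ℂ} (hg : Differentiable ℂ g) {B : ℝ}
    (hB : ∀ z : ℂ, 0 ≤ z.re → ‖g z‖ ≤ B) {a : ℝ} (ha : 0 < a) (h0 : g a = 0) :
    ∃ h : ℂ → ℂ, Differentiable ℂ h ∧ (∀ z : ℂ, 0 ≤ z.re → ‖h z‖ ≤ B) ∧
      ∀ z, h z * (z - a) = g z * (z + a) := by
  have hmul : ∀ z, dslope g a z * (z + a) * (z - a) = g z * (z + a) := fun z => by
    have := sub_smul_dslope g (a : ℂ) z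
    rw [h0, sub_zero, smul_eq_mul] at this
    rw [← this]; ring
  have hd : Differentiable ℂ (fun z => dslope g a z * (z + a)) := by
    refine Differentiable.mul ?_ (by fun_prop)
    rw [← differentiableOn_univ, Complex.differentiableOn_dslope univ_mem]
    exact hg.differentiableOn
  have hB0 : 0 ≤ B := (norm_nonneg _).trans (hB 0 le_rfl)
  have hlarge : ∀ z : ℂ, 0 ≤ z.re → 3 * a ≤ ‖z‖ → ‖dslope g a z * (z + a)‖ ≤ 2 * B := by
    intro z hz hza
    have hsub : ‖z‖ - a ≤ ‖z - a‖ := by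
      simpa [abs_of_pos ha] using norm_sub_norm_le z (a : ℂ)
    have hadd : ‖z + a‖ ≤ ‖z‖ + a := by
      simpa [abs_of_pos ha] using norm_add_le z (a : ℂ)
    have hpos : 0 < ‖z - a‖ := by linarith
    have h1 := congrArg norm (hmul z)
    rw [norm_mul, norm_mul (g z)] at h1
    refine le_of_mul_le_mul_right ?_ hpos
    rw [h1]
    calc ‖g z‖ * ‖z + a‖ ≤ B * (2 * ‖z - a‖) := by
          gcongr
          · exact hB z hz
          · linarith
      _ = _ := by ring
  refine ⟨_, hd, fun z hz => ?_, hmul⟩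
  refine PhragmenLindelof.right_half_plane_of_bounded_on_real
    (f := fun z => dslope g a z * (z + a)) hd.diffContOnCl ⟨0, by norm_num, 0, ?_⟩ ?_ ?_ hz
  · refine IsBigO.of_bound (2 * B) ?_
    rw [eventually_inf_principal]
    have : ∀ᶠ z : ℂ in cobounded ℂ, 3 * a ≤ ‖z‖ :=
      tendsto_norm_cobounded_atTop.eventually_ge_atTop _
    filter_upwards [this] with z hz hre
    simpa using hlarge z (le_of_lt hre) hz
  · refine ⟨2 * B, eventually_map.2 ?_⟩
    filter_upwards [eventually_ge_atTop (3 * a)] with x hx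
    have hx0 : 0 ≤ x := by linarith
    exact hlarge x (by simpa using hx0) (by simpa [abs_of_nonneg hx0] using hx)
  · intro y
    have h1 := congrArg norm (hmul (y * Complex.I))
    have h2 : ‖(y * Complex.I + a : ℂ)‖ = ‖(y * Complex.I - a : ℂ)‖ := by
      rw [← Complex.norm_conj (y * Complex.I - a), ← norm_neg]
      congr 1
      simp
      ring
    have hne : ‖(y * Complex.I - a : ℂ)‖ ≠ 0 := by
      rw [norm_ne_zero_iff]
      intro h
      have := congrArg Complex.re h
      simp at this
      exact ha.ne' this
    rw [norm_mul, norm_mul (g _), h2] at h1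
    rw [mul_right_cancel₀ hne h1]
    exact hB _ (by simp)

/-- Blaschke product bound for finitely many positive zeros. -/
theorem norm_mul_prod_le_of_zeros {a : ℕ → ℝ} (ha : ∀ k, 0 < a k) (hinj : Function.Injective a)
    {B : ℝ} (s : Finset ℕ) {g : ℂ → ℂ} (hg : Differentiable ℂ g)
    (hB : ∀ z : ℂ, 0 ≤ z.re → ‖g z‖ ≤ B) (h0 : ∀ k ∈ s, g (a k) = 0) {z : ℂ} (hz : 0 ≤ z.re) :
    ‖g z‖ * ∏ k ∈ s, ‖z + a k‖ ≤ B * ∏ k ∈ s, ‖z - a k‖ := by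
  induction s using Finset.induction_on generalizing g with
  | empty => simpa using hB z hz
  | insert j s hj ih =>
    obtain ⟨h, hd, hhB, hmul⟩ := exists_blaschke_quotient hg hB (ha j) (h0 j (by simp))
    have key := ih hd hhB fun k hk => by
      have h1 := hmul (a k)
      rw [h0 k (by simp [hk]), zero_mul, mul_eq_zero, sub_eq_zero, Complex.ofReal_inj] at h1
      exact h1.resolve_right fun h => hj (hinj h ▸ hk)
    rw [Finset.prod_insert hj, Finset.prod_insert hj, ← mul_assoc, ← norm_mul, ← hmul z, norm_mul]
    calc ‖h z‖ * ‖z - a j‖ * ∏ k ∈ s, ‖z + a k‖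
        = (‖h z‖ * ∏ k ∈ s, ‖z + a k‖) * ‖z - a j‖ := by ring
      _ ≤ (B * ∏ k ∈ s, ‖z - a k‖) * ‖z - a j‖ := by gcongr
      _ = _ := by ring

/-- A bounded holomorphic function on the right half-plane whose positive zeros violate the
Blaschke condition vanishes on `(0, 1)`. -/
theorem eq_zero_of_not_summable_inv_zeros {a : ℕ → ℝ} (ha : ∀ k, 0 < a k)
    (hinj : Function.Injective a) (hfin : {k | a k < 1}.Finite)
    (hdiv : ¬ Summable fun k => 1 / a k) {g : ℂ → ℂ} (hg : Differentiable ℂ g) {B : ℝ}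
    (hB : ∀ z : ℂ, 0 ≤ z.re → ‖g z‖ ≤ B) (h0 : ∀ k, g (a k) = 0) {x : ℝ} (hx : x ∈ Ioo (0:ℝ) 1) :
    g x = 0 := by
  obtain ⟨hx0, hx1⟩ := hx
  by_contra hne
  have hgx : 0 < ‖g x‖ := norm_pos_iff.2 hne
  have hBpos : 0 < B := hgx.trans_le (hB x (by simpa using hx0.le))
  let f : ℕ → ℝ := {k | 1 ≤ a k}.indicator fun k => 1 / a k
  have hf0 : 0 ≤ f := fun k => indicator_nonneg (fun k _ => (one_div_pos.2 (ha k)).le) k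
  have hfactor : ∀ k, ‖(x - a k : ℂ)‖ ≤ Real.exp (-(x * f k)) * ‖(x + a k : ℂ)‖ := by
    intro k
    have hak := ha k
    rw [← Complex.ofReal_sub, ← Complex.ofReal_add, Complex.norm_real, Complex.norm_real,
      Real.norm_eq_abs, Real.norm_of_nonneg (by linarith)]
    by_cases hk : 1 ≤ a k
    · have hfk : f k = 1 / a k := indicator_of_mem hk _
      rw [hfk, abs_sub_comm, abs_of_nonneg (by linarith)]
      have h1 := Real.add_one_le_exp (-(x * (1 / a k)))
      calc a k - x ≤ (-(x * (1 / a k)) + 1) * (x + a k) := by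
            have : (-(x * (1 / a k)) + 1) * (x + a k) = a k - x * x / a k := by
              field_simp; ring
            rw [this]
            have : x * x / a k ≤ x := by
              rw [div_le_iff₀ hak]; nlinarith
            linarith
        _ ≤ _ := by gcongr
    · have hfk : f k = 0 := indicator_of_notMem hk _
      rw [hfk]
      simp only [mul_zero, neg_zero, Real.exp_zero, one_mul]
      rw [abs_le]; constructor <;> linarith
  have hsum : Summable f := by
    refine summable_of_sum_le (c := Real.log (B / ‖g x‖) / x) hf0 fun s => ?_
    have h1 := norm_mul_prod_le_of_zeros ha hinj s hg hB (fun k _ => h0 k) (z := x)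
      (by simpa using hx0.le)
    have hP : 0 < ∏ k ∈ s, ‖(x + a k : ℂ)‖ := by
      refine Finset.prod_pos fun k _ => ?_
      have := ha k
      rw [← Complex.ofReal_add, Complex.norm_real, Real.norm_of_nonneg (by linarith)]
      linarith
    have h2 : ∏ k ∈ s, ‖(x - a k : ℂ)‖ ≤
        Real.exp (-(x * ∑ k ∈ s, f k)) * ∏ k ∈ s, ‖(x + a k : ℂ)‖ := by
      refine (Finset.prod_le_prod (fun _ _ => norm_nonneg _) fun k _ => hfactor k).trans_eq ?_
      rw [Finset.prod_mul_distrib, ← Real.exp_sum, Finset.mul_sum, Finset.sum_neg_distrib]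
    have h3 : ‖g x‖ ≤ B * Real.exp (-(x * ∑ k ∈ s, f k)) := by
      refine le_of_mul_le_mul_right (h1.trans ?_) hP
      rw [mul_assoc]
      gcongr
    rw [le_div_iff₀ hx0, Real.le_log_iff_exp_le (by positivity), le_div_iff₀ hgx, mul_comm _ x]
    rw [Real.exp_neg, ← div_eq_mul_inv, le_div_iff₀ (Real.exp_pos _)] at h3
    linarith
  refine hdiv ((summable_congr_cofinite ?_).1 hsum)
  filter_upwards [hfin.compl_mem_cofinite] with k hk
  exact indicator_of_mem (by simpa using hk) _

/-- An entire function with infinitely many zeros in a bounded set vanishes identically. -/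
theorem eq_zero_of_infinite_zeros {F : ℂ → ℂ} (hF : Differentiable ℂ F) {t : Set ℂ}
    (ht : t.Infinite) {R : ℝ} (htR : t ⊆ Metric.closedBall 0 R) (h0 : ∀ z ∈ t, F z = 0) (z : ℂ) :
    F z = 0 := by
  obtain ⟨w, -, hw⟩ := ht.exists_accPt_of_subset_isCompact (isCompact_closedBall 0 R) htR
  have hana := hF.differentiableOn.analyticOnNhd isOpen_univ
  exact hana.eqOn_zero_of_preconnected_of_frequently_eq_zero isPreconnected_univ
    (mem_univ w) ((accPt_iff_frequently_nhdsNE.1 hw).mono h0) (mem_univ z)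

namespace IsSol

variable {Q : ℝ → ℝ} {μ ν : ℂ} {u u' v v' c c' s s' : ℝ → ℂ}

theorem continuousOn (h : IsSol Q μ v v') : ContinuousOn v (Icc 0 1) :=
  fun x hx => (h.1 x hx).continuousWithinAt

theorem continuousOn' (h : IsSol Q μ v v') : ContinuousOn v' (Icc 0 1) :=
  fun x hx => (h.2 x hx).continuousWithinAt

/-- Weighted energy estimate for solutions. The freedom in `ρ` makes it serve both as a local bound
and, for `μ = z ^ 2` and `ρ = ‖z‖`, as a bound of sharp exponential type. -/
theorem energy_le (h : IsSol Q μ v v') {M : ℝ} (hM : ∀ x ∈ Icc (0:ℝ) 1, |Q x| ≤ M) {ρ : ℝ}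
    (hρ : 0 < ρ) {x : ℝ} (hx : x ∈ Icc (0:ℝ) 1) :
    ‖v' x‖ ^ 2 + ρ ^ 2 * ‖v x‖ ^ 2 ≤
      (‖v' 0‖ ^ 2 + ρ ^ 2 * ‖v 0‖ ^ 2) * Real.exp ((‖(ρ:ℂ) ^ 2 + μ‖ + M) / ρ * x) := by
  have hN0 : ∀ y, 0 ≤ ‖v' y‖ ^ 2 + ρ ^ 2 * ‖v y‖ ^ 2 := fun y => by positivity
  have key := norm_le_gronwallBound_of_norm_deriv_right_le
    (f := fun y => ‖v' y‖ ^ 2 + ρ ^ 2 * ‖v y‖ ^ 2)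
    (f' := fun y => 2 * inner ℝ (v' y) ((↑(Q y) + μ) * v y) + ρ ^ 2 * (2 * inner ℝ (v y) (v' y)))
    (δ := ‖v' 0‖ ^ 2 + ρ ^ 2 * ‖v 0‖ ^ 2) (K := (‖(ρ:ℂ) ^ 2 + μ‖ + M) / ρ) (ε := 0)
    (a := 0) (b := 1) ?_ ?_ ?_ ?_ x hx
  · rwa [gronwallBound_ε0, Real.norm_of_nonneg (hN0 x), sub_zero] at key
  · exact (h.continuousOn'.norm.pow 2).add (continuousOn_const.mul (h.continuousOn.norm.pow 2))
  · intro y hy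
    have hm := Icc_mem_nhdsGE_of_mem hy
    have hy' := Ico_subset_Icc_self hy
    exact (((h.2 y hy').norm_sq).add (((h.1 y hy').norm_sq).const_mul _)).mono_of_mem_nhdsWithin hm
  · exact (Real.norm_of_nonneg (hN0 0)).le
  · intro y hy
    have hy' := Ico_subset_Icc_self hy
    rw [Real.norm_of_nonneg (hN0 y), add_zero]
    have e : 2 * inner ℝ (v' y) ((↑(Q y) + μ) * v y) + ρ ^ 2 * (2 * inner ℝ (v y) (v' y)) =
        2 * inner ℝ (v' y) (((ρ:ℂ) ^ 2 + μ + Q y) * v y) := by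
      have e1 : ((ρ:ℂ) ^ 2 + μ + Q y) * v y = (↑(Q y) + μ) * v y + (ρ ^ 2 : ℝ) • v y := by
        rw [Complex.real_smul]; push_cast; ring
      rw [e1, inner_add_right, inner_smul_right, real_inner_comm (v' y) (v y)]
      ring
    rw [e, norm_mul, Real.norm_ofNat]
    have h1 := norm_inner_le_norm (𝕜 := ℝ) (v' y) (((ρ:ℂ) ^ 2 + μ + Q y) * v y)
    have h2 : ‖(ρ:ℂ) ^ 2 + μ + Q y‖ ≤ ‖(ρ:ℂ) ^ 2 + μ‖ + M := by
      refine (norm_add_le _ _).trans ?_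
      rw [Complex.norm_real]
      exact add_le_add le_rfl (hM y hy')
    have hK : 0 ≤ ‖(ρ:ℂ) ^ 2 + μ‖ + M := (norm_nonneg _).trans h2
    rw [norm_mul] at h1
    calc 2 * ‖inner ℝ (v' y) (((ρ:ℂ) ^ 2 + μ + Q y) * v y)‖
        ≤ 2 * (‖v' y‖ * ((‖(ρ:ℂ) ^ 2 + μ‖ + M) * ‖v y‖)) := by
          gcongr
          exact h1.trans (by gcongr)
      _ = (‖(ρ:ℂ) ^ 2 + μ‖ + M) / ρ * (2 * ‖v' y‖ * (ρ * ‖v y‖)) := by field_simp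
      _ ≤ _ := by
          gcongr
          have := two_mul_le_add_sq ‖v' y‖ (ρ * ‖v y‖)
          rwa [mul_pow] at this

theorem norm_le (h : IsSol Q μ v v') {M : ℝ} (hM : ∀ x ∈ Icc (0:ℝ) 1, |Q x| ≤ M)
    {x : ℝ} (hx : x ∈ Icc (0:ℝ) 1) :
    ‖v x‖ ≤ (‖v' 0‖ + ‖v 0‖) * Real.exp (1 + ‖μ‖ + M) := by
  have hM0 : 0 ≤ M := (abs_nonneg _).trans (hM x hx)
  have h1 := h.energy_le hM one_pos hx
  simp only [one_pow, one_mul, Complex.ofReal_one, div_one] at h1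
  have hn : ‖(1 : ℂ) + μ‖ ≤ 1 + ‖μ‖ := by simpa using norm_add_le (1 : ℂ) μ
  have h3 : (‖(1 : ℂ) + μ‖ + M) * x ≤ 1 + ‖μ‖ + M := by
    have := norm_nonneg ((1 : ℂ) + μ)
    nlinarith [hx.1, hx.2]
  have h4 : (1 : ℝ) ≤ Real.exp (1 + ‖μ‖ + M) := Real.one_le_exp (by positivity)
  refine abs_le_of_sq_le_sq' ?_ (by positivity) |>.2
  calc ‖v x‖ ^ 2 ≤ ‖v' x‖ ^ 2 + ‖v x‖ ^ 2 := by nlinarith [sq_nonneg ‖v' x‖]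
    _ ≤ (‖v' 0‖ ^ 2 + ‖v 0‖ ^ 2) * Real.exp (1 + ‖μ‖ + M) := h1.trans (by gcongr)
    _ ≤ (‖v' 0‖ + ‖v 0‖) ^ 2 * Real.exp (1 + ‖μ‖ + M) ^ 2 := by
        gcongr
        · nlinarith [norm_nonneg (v' 0), norm_nonneg (v 0)]
        · nlinarith
    _ = _ := by ring

/-- Bound of sharp exponential type for the value at `1` of a normalised solution. -/
theorem norm_apply_one_le {z : ℂ} (h : IsSol Q (z ^ 2) v v') {M : ℝ}
    (hM : ∀ x ∈ Icc (0:ℝ) 1, |Q x| ≤ M) (hre : 0 ≤ z.re) (hz : 1 ≤ ‖z‖)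
    (h0 : ‖v' 0‖ ^ 2 + ‖z‖ ^ 2 * ‖v 0‖ ^ 2 ≤ ‖z‖ ^ 2) : ‖v 1‖ ≤ Real.exp (z.re + M) := by
  have hM0 : 0 ≤ M := (abs_nonneg _).trans (hM 0 (by simp))
  have hz0 : 0 < ‖z‖ := by linarith
  have h1 := h.energy_le hM hz0 (x := 1) (by simp)
  have e : ‖(‖z‖:ℂ) ^ 2 + z ^ 2‖ = 2 * z.re * ‖z‖ := by
    have e1 : (‖z‖:ℂ) ^ 2 + z ^ 2 = ((2 * z.re : ℝ) : ℂ) * z := by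
      rw [← Complex.add_conj, ← Complex.mul_conj']; ring
    rw [e1, norm_mul, Complex.norm_real, Real.norm_of_nonneg (by positivity)]
  rw [e, mul_one] at h1
  have h2 : (2 * z.re * ‖z‖ + M) / ‖z‖ ≤ 2 * (z.re + M) := by
    rw [div_le_iff₀ hz0]; nlinarith
  have h3 : ‖z‖ ^ 2 * ‖v 1‖ ^ 2 ≤ ‖z‖ ^ 2 * Real.exp (z.re + M) ^ 2 := by
    rw [← Real.exp_nat_mul]
    calc ‖z‖ ^ 2 * ‖v 1‖ ^ 2 ≤ ‖v' 1‖ ^ 2 + ‖z‖ ^ 2 * ‖v 1‖ ^ 2 := by nlinarith [sq_nonneg ‖v' 1‖]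
      _ ≤ _ := h1.trans (by push_cast; gcongr)
  exact abs_le_of_sq_le_sq' (le_of_mul_le_mul_left h3 (by positivity)) (by positivity) |>.2

theorem wronskian_eq_one (hc : IsSol Q μ c c') (hs : IsSol Q μ s s')
    (hc0 : c 0 = 1) (hc0' : c' 0 = 0) (hs0' : s' 0 = 1) {x : ℝ}
    (hx : x ∈ Icc (0:ℝ) 1) : c x * s' x - c' x * s x = 1 := by
  have key := constant_of_has_deriv_right_zero (f := fun y => c y * s' y - c' y * s y)
    ((hc.continuousOn.mul hs.continuousOn').sub (hc.continuousOn'.mul hs.continuousOn))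
    (fun y hy => by
      have hy' := Ico_subset_Icc_self hy
      have := ((hc.1 y hy').mul (hs.2 y hy')).sub ((hc.2 y hy').mul (hs.1 y hy'))
      refine HasDerivWithinAt.congr_deriv
        (this.mono_of_mem_nhdsWithin (Icc_mem_nhdsGE_of_mem hy)) ?_
      ring) x hx
  simpa [hc0, hc0', hs0'] using key

/-- Variation of constants. -/
theorem sub_eq_integral (hc : IsSol Q μ c c') (hs : IsSol Q μ s s')
    (hc0 : c 0 = 1) (hc0' : c' 0 = 0) (hs0' : s' 0 = 1)
    (hu : IsSol Q ν u u') (hv : IsSol Q μ v v') (h0 : u 0 = v 0) (h0' : u' 0 = v' 0) {x : ℝ}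
    (hx : x ∈ Icc (0:ℝ) 1) :
    u x - v x = (ν - μ) * ∫ t in (0:ℝ)..x, (s x * c t - c x * s t) * u t := by
  have hsub : Icc 0 x ⊆ Icc (0:ℝ) 1 := Icc_subset_Icc_right hx.2
  have key := intervalIntegral.integral_eq_sub_of_hasDerivAt_of_le hx.1
    (f := fun t => (u' t - v' t) * (s x * c t - c x * s t) -
      (u t - v t) * (s x * c' t - c x * s' t))
    (f' := fun t => (ν - μ) * ((s x * c t - c x * s t) * u t)) ?_ ?_ ?_
  · rw [intervalIntegral.integral_const_mul] at key
    rw [key]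
    have hw := wronskian_eq_one hc hs hc0 hc0' hs0' hx
    simp only [h0, h0', sub_self, zero_mul, sub_zero]
    linear_combination (-(u x - v x)) * hw
  · refine ContinuousOn.mono ?_ hsub
    have := hu.continuousOn; have := hu.continuousOn'
    have := hv.continuousOn; have := hv.continuousOn'
    have := hc.continuousOn; have := hc.continuousOn'
    have := hs.continuousOn; have := hs.continuousOn'
    fun_prop
  · intro t ht
    have ht' : t ∈ Icc (0:ℝ) 1 := hsub (Ioo_subset_Icc_self ht)
    have hn : Icc (0:ℝ) 1 ∈ 𝓝 t := Icc_mem_nhds ht.1 (ht.2.trans_le hx.2)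
    have := (((hu.2 t ht').sub (hv.2 t ht')).mul
      (((hc.1 t ht').const_mul (s x)).sub ((hs.1 t ht').const_mul (c x)))).sub
      (((hu.1 t ht').sub (hv.1 t ht')).mul
      (((hc.2 t ht').const_mul (s x)).sub ((hs.2 t ht').const_mul (c x))))
    refine (this.hasDerivAt hn).congr_deriv ?_
    simp only [Pi.sub_apply]
    ring
  · refine ContinuousOn.intervalIntegrable ?_
    rw [uIcc_of_le hx.1]
    refine ContinuousOn.mono ?_ hsub
    have := hu.continuousOn; have := hc.continuousOn; have := hs.continuousOn
    fun_prop

end IsSol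

/-- Values at `1` of solutions with fixed initial data are entire in the spectral parameter. -/
theorem differentiable_solution_apply_one {Q : ℝ → ℝ} {M : ℝ}
    (hM : ∀ x ∈ Icc (0:ℝ) 1, |Q x| ≤ M) {S S' C C' U U' : ℂ → ℝ → ℂ} {α β : ℂ}
    (hS : ∀ μ : ℂ, IsSol Q μ (S μ) (S' μ) ∧ S μ 0 = 0 ∧ S' μ 0 = 1)
    (hC : ∀ μ : ℂ, IsSol Q μ (C μ) (C' μ) ∧ C μ 0 = 1 ∧ C' μ 0 = 0)
    (hU : ∀ μ : ℂ, IsSol Q μ (U μ) (U' μ) ∧ U μ 0 = α ∧ U' μ 0 = β) :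
    Differentiable ℂ fun μ => U μ 1 := by
  intro μ
  have hM0 : 0 ≤ M := (abs_nonneg _).trans (hM 0 (by simp))
  obtain ⟨hs, hs0, hs0'⟩ := hS μ
  obtain ⟨hc, hc0, hc0'⟩ := hC μ
  obtain ⟨hu, hu0, hu0'⟩ := hU μ
  let A : ℝ := Real.exp (1 + ‖μ‖ + M)
  let L : ℝ := (‖β‖ + ‖α‖) * Real.exp (1 + (‖μ‖ + 1) + M)
  have hA : 0 ≤ A := (Real.exp_pos _).le
  have hL : 0 ≤ L := by positivity
  have hsA : ∀ x ∈ Icc (0:ℝ) 1, ‖S μ x‖ ≤ A := fun x hx => by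
    simpa [hs0, hs0'] using hs.norm_le hM hx
  have hcA : ∀ x ∈ Icc (0:ℝ) 1, ‖C μ x‖ ≤ A := fun x hx => by
    simpa [hc0, hc0'] using hc.norm_le hM hx
  have hkernel : ∀ x ∈ Icc (0:ℝ) 1, ∀ t ∈ Icc (0:ℝ) 1,
      ‖S μ x * C μ t - C μ x * S μ t‖ ≤ 2 * A ^ 2 := fun x hx t ht => by
    refine (norm_sub_le _ _).trans ?_
    rw [norm_mul, norm_mul]
    have h1 := mul_le_mul (hsA x hx) (hcA t ht) (norm_nonneg _) hA
    have h2 := mul_le_mul (hcA x hx) (hsA t ht) (norm_nonneg _) hA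
    linarith
  have hsubset : ∀ {x : ℝ}, x ∈ Icc (0:ℝ) 1 → uIoc 0 x ⊆ Icc (0:ℝ) 1 := fun {x} hx t ht => by
    rw [uIoc_of_le hx.1] at ht
    exact ⟨ht.1.le, ht.2.trans hx.2⟩
  have hduhamel : ∀ ν, ∀ x ∈ Icc (0:ℝ) 1, U ν x - U μ x =
      (ν - μ) * ∫ t in (0:ℝ)..x, (S μ x * C μ t - C μ x * S μ t) * U ν t := fun ν x hx =>
    IsSol.sub_eq_integral hc hs hc0 hc0' hs0' (hU ν).1 hu ((hU ν).2.1.trans hu0.symm)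
      ((hU ν).2.2.trans hu0'.symm) hx
  have hdiff : ∀ ν, ‖ν - μ‖ ≤ 1 → ∀ x ∈ Icc (0:ℝ) 1,
      ‖U ν x - U μ x‖ ≤ ‖ν - μ‖ * (2 * A ^ 2 * L) := by
    intro ν hν x hx
    have hνn : ‖ν‖ ≤ ‖μ‖ + 1 := by linarith [norm_le_norm_add_norm_sub' ν μ]
    rw [hduhamel ν x hx, norm_mul]
    gcongr
    refine (intervalIntegral.norm_integral_le_of_norm_le_const (C := 2 * A ^ 2 * L)
      fun t ht => ?_).trans ?_
    · rw [norm_mul]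
      refine mul_le_mul (hkernel x hx t (hsubset hx ht)) ?_ (norm_nonneg _) (by positivity)
      have := (hU ν).1.norm_le hM (hsubset hx ht)
      rw [(hU ν).2.1, (hU ν).2.2] at this
      exact this.trans (by simp only [L]; gcongr)
    · rw [sub_zero, abs_of_nonneg hx.1]
      exact mul_le_of_le_one_right (by positivity) hx.2
  have h1mem : (1:ℝ) ∈ Icc (0:ℝ) 1 := by simp
  have hint : ∀ ν, IntervalIntegrable
      (fun t => (S μ 1 * C μ t - C μ 1 * S μ t) * U ν t) MeasureTheory.volume 0 1 := fun ν => by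
    refine ContinuousOn.intervalIntegrable ?_
    rw [uIcc_of_le zero_le_one]
    have := (hU ν).1.continuousOn; have := hc.continuousOn; have := hs.continuousOn
    fun_prop
  have hderiv : HasDerivAt (fun ν => U ν 1)
      (∫ t in (0:ℝ)..1, (S μ 1 * C μ t - C μ 1 * S μ t) * U μ t) μ := by
    rw [hasDerivAt_iff_isLittleO]
    refine IsBigO.trans_isLittleO ?_ (isLittleO_pow_sub_sub μ one_lt_two)
    refine IsBigO.of_bound (2 * A ^ 2 * (2 * A ^ 2 * L)) ?_
    filter_upwards [Metric.closedBall_mem_nhds μ one_pos] with ν hν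
    rw [mem_closedBall_iff_norm] at hν
    have e : U ν 1 - U μ 1 -
        (ν - μ) • ∫ t in (0:ℝ)..1, (S μ 1 * C μ t - C μ 1 * S μ t) * U μ t =
        (ν - μ) * ∫ t in (0:ℝ)..1, (S μ 1 * C μ t - C μ 1 * S μ t) * (U ν t - U μ t) := by
      simp only [mul_sub ((S μ 1 * C μ _ - C μ 1 * S μ _))]
      rw [hduhamel ν 1 h1mem, intervalIntegral.integral_sub (hint ν) (hint μ), smul_eq_mul, mul_sub]
    rw [e, norm_mul]
    have hI := intervalIntegral.norm_integral_le_of_norm_le_const (a := 0) (b := 1)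
      (f := fun t => (S μ 1 * C μ t - C μ 1 * S μ t) * (U ν t - U μ t))
      (C := 2 * A ^ 2 * (‖ν - μ‖ * (2 * A ^ 2 * L))) fun t ht => by
        rw [norm_mul]
        exact mul_le_mul (hkernel 1 h1mem t (hsubset h1mem ht))
          (hdiff ν hν t (hsubset h1mem ht)) (norm_nonneg _) (by positivity)
    calc _ ≤ ‖ν - μ‖ * (2 * A ^ 2 * (‖ν - μ‖ * (2 * A ^ 2 * L)) * |1 - 0|) := by gcongr
      _ = _ := by simp; ring
  exact hderiv.differentiableAt

/-- If `D_Q(μ_k)·Δ_{Q̃}(μ_k) = D_{Q̃}(μ_k)·Δ_Q(μ_k)` along a sequence of distinct positive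
reals `μ_k` with `Σ 1/√μ_k = ∞`, then the identity holds for all `μ ∈ ℂ`.
Here `Δ_Q(μ) = s₀(1,μ)` and `D_Q(μ) = c₀(1,μ)`. -/
theorem weyl_titchmarsh_determined_by_sequence
    (Q Qt : ℝ → ℝ) (hQ : ContinuousOn Q (Icc (0:ℝ) 1)) (hQt : ContinuousOn Qt (Icc (0:ℝ) 1))
    (S S' C C' St St' Ct Ct' : ℂ → ℝ → ℂ)
    (hS : ∀ μ : ℂ, IsSol Q μ (S μ) (S' μ) ∧ S μ 0 = 0 ∧ S' μ 0 = 1)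
    (hC : ∀ μ : ℂ, IsSol Q μ (C μ) (C' μ) ∧ C μ 0 = 1 ∧ C' μ 0 = 0)
    (hSt : ∀ μ : ℂ, IsSol Qt μ (St μ) (St' μ) ∧ St μ 0 = 0 ∧ St' μ 0 = 1)
    (hCt : ∀ μ : ℂ, IsSol Qt μ (Ct μ) (Ct' μ) ∧ Ct μ 0 = 1 ∧ Ct' μ 0 = 0)
    (μk : ℕ → ℝ) (hpos : ∀ k, 0 < μk k) (hinj : Function.Injective μk)
    (hdiv : ¬ Summable (fun k => 1 / Real.sqrt (μk k)))
    (heq : ∀ k, C (↑(μk k)) 1 * St (↑(μk k)) 1 = Ct (↑(μk k)) 1 * S (↑(μk k)) 1) :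
    ∀ μ : ℂ, C μ 1 * St μ 1 = Ct μ 1 * S μ 1 := by
  obtain ⟨M, hM⟩ := isCompact_Icc.exists_bound_of_continuousOn hQ
  obtain ⟨Mt, hMt⟩ := isCompact_Icc.exists_bound_of_continuousOn hQt
  let F : ℂ → ℂ := fun μ => C μ 1 * St μ 1 - Ct μ 1 * S μ 1
  have hF : Differentiable ℂ F :=
    ((differentiable_solution_apply_one hM hS hC hC).mul
      (differentiable_solution_apply_one hMt hSt hCt hSt)).sub
    ((differentiable_solution_apply_one hMt hSt hCt hCt).mul
      (differentiable_solution_apply_one hM hS hC hS))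
  suffices ∀ μ, F μ = 0 from fun μ => sub_eq_zero.1 (this μ)
  have hF0 : ∀ k, F (μk k) = 0 := fun k => sub_eq_zero.2 (heq k)
  by_cases hfin : {k | √(μk k) < 1}.Finite
  · let g : ℂ → ℂ := fun z => F (z ^ 2) * Complex.exp (-(2 * z))
    have hg : Differentiable ℂ g :=
      (hF.comp (differentiable_id.pow 2)).mul (by fun_prop)
    obtain ⟨B, hB⟩ := (isCompact_closedBall (0 : ℂ) 1).exists_bound_of_continuousOn
      hg.continuous.continuousOn
    have hgB : ∀ z : ℂ, 0 ≤ z.re → ‖g z‖ ≤ max B (2 * Real.exp (M + Mt)) := by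
      intro z hre
      rcases le_total ‖z‖ 1 with hz | hz
      · exact (hB z (by simpa using hz)).trans (le_max_left _ _)
      · refine le_trans ?_ (le_max_right _ _)
        have hc := (hC (z ^ 2)).1.norm_apply_one_le hM hre hz (by simp [hC])
        have hs := (hS (z ^ 2)).1.norm_apply_one_le hM hre hz (by simpa [hS] using hz)
        have hct := (hCt (z ^ 2)).1.norm_apply_one_le hMt hre hz (by simp [hCt])
        have hst := (hSt (z ^ 2)).1.norm_apply_one_le hMt hre hz (by simpa [hSt] using hz)
        have hFz : ‖F (z ^ 2)‖ ≤ 2 * (Real.exp (z.re + M) * Real.exp (z.re + Mt)) := by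
          refine (norm_sub_le _ _).trans ?_
          rw [norm_mul, norm_mul]
          have h1 := mul_le_mul hc hst (norm_nonneg _) (Real.exp_pos _).le
          have h2 := mul_le_mul hct hs (norm_nonneg _) (Real.exp_pos _).le
          linarith
        have he : ‖Complex.exp (-(2 * z))‖ = Real.exp (-(2 * z.re)) := by
          simp [Complex.norm_exp]
        calc ‖g z‖ = ‖F (z ^ 2)‖ * Real.exp (-(2 * z.re)) := by rw [← he, ← norm_mul]
          _ ≤ 2 * (Real.exp (z.re + M) * Real.exp (z.re + Mt)) * Real.exp (-(2 * z.re)) := by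
              gcongr
          _ = 2 * Real.exp (M + Mt) := by
              rw [mul_assoc, ← Real.exp_add, ← Real.exp_add]
              ring_nf
    have hsqrt : ∀ k, ((√(μk k) : ℝ) : ℂ) ^ 2 = μk k := fun k => by
      rw [← Complex.ofReal_pow, Real.sq_sqrt (hpos k).le]
    have hsqrt_inj : Function.Injective fun k => √(μk k) := fun i j hij =>
      hinj ((Real.sqrt_inj (hpos i).le (hpos j).le).1 hij)
    have hzero : ∀ x ∈ Ioo (0:ℝ) 1, F (x ^ 2 : ℝ) = 0 := fun x hx => by
      have := eq_zero_of_not_summable_inv_zeros (fun k => Real.sqrt_pos.2 (hpos k)) hsqrt_inj hfin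
        hdiv hg hgB (fun k => by simp only [g, hsqrt, hF0, zero_mul]) hx
      simpa [g, Complex.exp_ne_zero] using this
    have hzero' : ∀ y ∈ Ioo (0:ℝ) 1, F y = 0 := fun y hy => by
      rw [← Real.sq_sqrt hy.1.le]
      exact hzero _ ⟨Real.sqrt_pos.2 hy.1, (Real.sqrt_lt' one_pos).2 (by simpa using hy.2)⟩
    refine eq_zero_of_infinite_zeros hF (R := 1)
      ((Ioo_infinite (zero_lt_one' ℝ)).image Complex.ofReal_injective.injOn) ?_ ?_
    · rintro _ ⟨y, hy, rfl⟩
      simpa [abs_of_pos hy.1] using hy.2.le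
    · rintro _ ⟨y, hy, rfl⟩
      exact hzero' y hy
  · refine eq_zero_of_infinite_zeros hF (R := 1) (Set.Infinite.image (f := fun k => (μk k : ℂ))
      (fun i _ j _ hij => hinj (Complex.ofReal_injective hij)) hfin) ?_ ?_
    · rintro _ ⟨k, hk, rfl⟩
      have : μk k < 1 := by simpa using (Real.sqrt_lt' one_pos).1 hk
      simpa [abs_of_pos (hpos k)] using this.le
    · rintro _ ⟨k, hk, rfl⟩
      exact hF0 k
end

section
/- Let Q, Q̃ : [0,1] → ℝ be continuous functions and let (μ_k)_{k≥1} be a sequence of distinct positive real numbers such that the series Σ_{k≥1} 1/√(μ_k) diverges. If Δ_Q(μ_k) = Δ_{Q̃}(μ_k) for every k ≥ 1, then Δ_Q(μ) = Δ_{Q̃}(μ) for all μ ∈ ℂ. -/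
open Set

open Filter Topology Metric

/-- Grönwall estimate for `u'' = p u + f` with zero initial data. -/
theorem norm_le_of_second_order_linear {p f u u' : ℝ → ℂ} {K ε : ℝ} (hK : 1 ≤ K) (hε : 0 ≤ ε)
    (hu : ∀ x ∈ Icc (0:ℝ) 1, HasDerivWithinAt u (u' x) (Icc (0:ℝ) 1) x)
    (hu' : ∀ x ∈ Icc (0:ℝ) 1, HasDerivWithinAt u' (p x * u x + f x) (Icc (0:ℝ) 1) x)
    (h0 : u 0 = 0) (h0' : u' 0 = 0) (hp : ∀ x ∈ Icc (0:ℝ) 1, ‖p x‖ ≤ K)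
    (hf : ∀ x ∈ Icc (0:ℝ) 1, ‖f x‖ ≤ ε) {x : ℝ} (hx : x ∈ Icc (0:ℝ) 1) :
    ‖u x‖ ≤ ε * Real.exp K := by
  have hderiv : ∀ x ∈ Icc (0:ℝ) 1,
      HasDerivWithinAt (fun y => (u y, u' y)) (u' x, p x * u x + f x) (Icc (0:ℝ) 1) x :=
    fun x hx => (hu x hx).prodMk (hu' x hx)
  have key := norm_le_gronwallBound_of_norm_deriv_right_le (δ := 0) (K := K) (ε := ε)
    (fun x hx => (hderiv x hx).continuousWithinAt)
    (fun x hx => ((hderiv x (Ico_subset_Icc_self hx)).mono_of_mem_nhdsWithin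
      (Icc_mem_nhdsGE_of_mem hx)))
    (by simp [h0, h0'])
    (fun x hx => by
      have hx' := Ico_subset_Icc_self hx
      have h1 : ‖u x‖ ≤ ‖(u x, u' x)‖ := norm_fst_le (u x, u' x)
      have h2 : ‖u' x‖ ≤ ‖(u x, u' x)‖ := norm_snd_le (u x, u' x)
      refine norm_prod_le_iff.2 ⟨?_, ?_⟩
      · nlinarith [norm_nonneg (u x, u' x)]
      · calc ‖p x * u x + f x‖ ≤ ‖p x‖ * ‖u x‖ + ‖f x‖ :=
              (norm_add_le _ _).trans_eq (by rw [norm_mul])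
          _ ≤ K * ‖(u x, u' x)‖ + ε := by
              gcongr
              exacts [hp x hx', hf x hx']) x hx
  rw [gronwallBound_of_K_ne_0 (by positivity)] at key
  have hexp : Real.exp (K * (x - 0)) ≤ Real.exp K :=
    Real.exp_le_exp.2 (by nlinarith [hx.1, hx.2])
  calc ‖u x‖ ≤ ‖(u x, u' x)‖ := norm_fst_le (u x, u' x)
    _ ≤ ε / K * (Real.exp (K * (x - 0)) - 1) := by simpa using key
    _ ≤ ε * Real.exp K := by
        have : ε / K ≤ ε := div_le_self hε hK
        have h1 : 0 ≤ Real.exp (K * (x - 0)) - 1 := by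
          have := Real.add_one_le_exp (K * (x - 0))
          nlinarith [hx.1, mul_nonneg (zero_le_one.trans hK) hx.1]
        nlinarith

/-- A function whose slopes at `a` are Lipschitz near `a` is differentiable at `a`. -/
theorem differentiableAt_of_slope_lipschitz {f : ℂ → ℂ} {a : ℂ} {C : ℝ}
    (h : ∀ z ∈ ball a 1, ∀ w ∈ ball a 1, z ≠ a → w ≠ a →
      dist (slope f a z) (slope f a w) ≤ C * dist z w) : DifferentiableAt ℂ f a := by
  have hC : Cauchy (map (slope f a) (𝓝[≠] a)) := by
    refine Metric.cauchy_iff.2 ⟨inferInstance, fun ε hε => ?_⟩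
    have hr : 0 < min 1 (ε / (2 * (|C| + 1))) := by positivity
    refine ⟨_, image_mem_map (inter_mem_nhdsWithin {a}ᶜ (ball_mem_nhds a hr)), ?_⟩
    rintro _ ⟨z, ⟨hza, hz⟩, rfl⟩ _ ⟨w, ⟨hwa, hw⟩, rfl⟩
    have hzw : dist z w < ε / (|C| + 1) := by
      have h1 := (mem_ball.1 hz).trans_le (min_le_right _ _)
      have h2 := (mem_ball'.1 hw).trans_le (min_le_right _ _)
      calc dist z w ≤ dist z a + dist a w := dist_triangle _ _ _
        _ < ε / (2 * (|C| + 1)) + ε / (2 * (|C| + 1)) := add_lt_add h1 h2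
        _ = ε / (|C| + 1) := by field_simp; ring
    calc dist (slope f a z) (slope f a w) ≤ C * dist z w :=
          h z (ball_subset_ball (min_le_left _ _) hz) w
            (ball_subset_ball (min_le_left _ _) hw) hza hwa
      _ ≤ (|C| + 1) * dist z w := by gcongr; linarith [le_abs_self C]
      _ < ε := by rwa [lt_div_iff₀' (by positivity)] at hzw
  obtain ⟨l, hl⟩ := cauchy_map_iff_exists_tendsto.1 hC
  exact (hasDerivAt_iff_tendsto_slope.2 hl).differentiableAt

/-- The value at `1` of the normalized solution is an entire function of the spectral
parameter. -/
theorem differentiable_characteristic {Q : ℝ → ℝ} (hQ : ContinuousOn Q (Icc (0:ℝ) 1))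
    {S S' : ℂ → ℝ → ℂ} (hS : ∀ μ : ℂ, IsSol Q μ (S μ) (S' μ) ∧ S μ 0 = 0 ∧ S' μ 0 = 1) :
    Differentiable ℂ (fun μ => S μ 1) := by
  intro a
  obtain ⟨q, hq⟩ := isCompact_Icc.exists_bound_of_continuousOn hQ
  set K : ℝ := |q| + ‖a‖ + 2 with hKdef
  have hK : 1 ≤ K := by linarith [abs_nonneg q, norm_nonneg a]
  have hp : ∀ z ∈ ball a 1, ∀ x ∈ Icc (0:ℝ) 1, ‖(Q x : ℂ) + z‖ ≤ K := by
    intro z hz x hx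
    have h1 : ‖(Q x : ℂ)‖ ≤ |q| := by
      rw [Complex.norm_real]; exact (hq x hx).trans (le_abs_self q)
    have h2 : ‖z‖ ≤ ‖a‖ + 1 := by
      rw [mem_ball, dist_eq_norm] at hz
      have h3 : ‖z‖ ≤ ‖a‖ + ‖z - a‖ := by simpa using norm_add_le a (z - a)
      linarith
    linarith [norm_add_le (Q x : ℂ) z]
  set M : ℝ := Real.exp K
  set B : ℝ := 1 + K * M
  have hM : 0 < M := Real.exp_pos K
  have hB0 : 0 ≤ B := by positivity
  have hbdd : ∀ z ∈ ball a 1, ∀ x ∈ Icc (0:ℝ) 1, ‖S z x‖ ≤ B := by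
    intro z hz x hx
    obtain ⟨⟨h1, h2⟩, h3, h4⟩ := hS z
    have key := norm_le_of_second_order_linear (p := fun x => (Q x : ℂ) + z)
      (f := fun x => ((Q x : ℂ) + z) * x) (u := fun x => S z x - x) (u' := fun x => S' z x - 1)
      (K := K) (ε := K) hK (by positivity)
      (fun x hx => (h1 x hx).sub (hasDerivAt_id x).ofReal_comp.hasDerivWithinAt)
      (fun x hx => ((h2 x hx).sub_const 1).congr_deriv (by ring))
      (by simp [h3]) (by simp [h4]) (hp z hz)
      (fun x hx => by
        rw [norm_mul, Complex.norm_real, Real.norm_of_nonneg hx.1]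
        nlinarith [hp z hz x hx, hx.1, hx.2]) hx
    have hx1 : ‖(x : ℂ)‖ ≤ 1 := by
      rw [Complex.norm_real, Real.norm_of_nonneg hx.1]; exact hx.2
    calc ‖S z x‖ = ‖(x : ℂ) + (S z x - x)‖ := by congr 1; ring
      _ ≤ B := (norm_add_le _ _).trans (add_le_add hx1 key)
  have hlip : ∀ z ∈ ball a 1, ∀ w ∈ ball a 1, ∀ x ∈ Icc (0:ℝ) 1,
      ‖S z x - S w x‖ ≤ dist z w * B * M := by
    intro z hz w hw x hx
    obtain ⟨⟨h1, h2⟩, h3, h4⟩ := hS z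
    obtain ⟨⟨k1, k2⟩, k3, k4⟩ := hS w
    exact norm_le_of_second_order_linear (p := fun x => (Q x : ℂ) + z)
      (f := fun x => (z - w) * S w x) (u := fun x => S z x - S w x)
      (u' := fun x => S' z x - S' w x) hK (by positivity)
      (fun x hx => (h1 x hx).sub (k1 x hx))
      (fun x hx => ((h2 x hx).sub (k2 x hx)).congr_deriv (by ring))
      (by simp [h3, k3]) (by simp [h4, k4]) (hp z hz)
      (fun x hx => by
        rw [norm_mul, ← dist_eq_norm]
        gcongr
        exact hbdd w hw x hx) hx
  refine differentiableAt_of_slope_lipschitz (C := B * M * M) fun z hz w hw hza hwa => ?_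
  obtain ⟨⟨h1, h2⟩, h3, h4⟩ := hS z
  obtain ⟨⟨k1, k2⟩, k3, k4⟩ := hS w
  obtain ⟨⟨l1, l2⟩, l3, l4⟩ := hS a
  have hza' : z - a ≠ 0 := sub_ne_zero.2 hza
  have hwa' : w - a ≠ 0 := sub_ne_zero.2 hwa
  have key := norm_le_of_second_order_linear (p := fun x => (Q x : ℂ) + a)
      (f := fun x => S z x - S w x)
      (u := fun x => (S z x - S a x) / (z - a) - (S w x - S a x) / (w - a))
      (u' := fun x => (S' z x - S' a x) / (z - a) - (S' w x - S' a x) / (w - a))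
      (ε := dist z w * B * M) hK (by positivity)
      (fun x hx => (((h1 x hx).sub (l1 x hx)).div_const _).sub
        (((k1 x hx).sub (l1 x hx)).div_const _))
      (fun x hx => ((((h2 x hx).sub (l2 x hx)).div_const _).sub
        (((k2 x hx).sub (l2 x hx)).div_const _)).congr_deriv (by field_simp; ring))
      (by simp [h3, k3, l3]) (by simp [h4, k4, l4]) (hp a (mem_ball_self one_pos))
      (fun x hx => hlip z hz w hw x hx) (right_mem_Icc.2 zero_le_one)
  rw [dist_eq_norm, slope_def_field, slope_def_field]
  exact key.trans_eq (by ring)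

/-- Exponential growth bound for the normalized solution at the spectral parameter `z ^ 2`. -/
theorem norm_sol_sq_le {Q : ℝ → ℝ} {q : ℝ} (hq : ∀ x ∈ Icc (0:ℝ) 1, |Q x| ≤ q)
    {z : ℂ} (hz : 0 ≤ z.re) {v v' : ℝ → ℂ} (hv : IsSol Q (z ^ 2) v v') (h0 : v 0 = 0)
    (h0' : v' 0 = 1) : ‖v 1‖ ≤ Real.exp z.re * Real.exp (1 + q) := by
  have hq0 : 0 ≤ q := (abs_nonneg _).trans (hq 0 (left_mem_Icc.2 zero_le_one))
  obtain ⟨h1, h2⟩ := hv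
  set V : ℝ → ℂ := fun x => Complex.exp (-z * x) * v x with hV
  set P : ℝ → ℂ := fun x => Complex.exp (-z * x) * (v' x + z * v x) with hP
  have hexp : ∀ x : ℝ, HasDerivAt (fun x : ℝ => Complex.exp (-z * x))
      (Complex.exp (-z * x) * -z) x := fun x => by
    simpa using ((hasDerivAt_id (x : ℂ)).const_mul (-z)).cexp.comp_ofReal
  have hVd : ∀ x ∈ Icc (0:ℝ) 1,
      HasDerivWithinAt V (-2 * (z * V x) + P x) (Icc (0:ℝ) 1) x := fun x hx =>
    ((hexp x).hasDerivWithinAt.mul (h1 x hx)).congr_deriv (by simp only [hV, hP]; ring)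
  have hPd : ∀ x ∈ Icc (0:ℝ) 1,
      HasDerivWithinAt P ((Q x : ℂ) * V x) (Icc (0:ℝ) 1) x := fun x hx =>
    ((hexp x).hasDerivWithinAt.mul ((h2 x hx).add ((h1 x hx).const_mul z))).congr_deriv
      (by simp only [hV, Pi.add_apply]; ring)
  set E : ℝ → ℝ := fun x => Real.exp (-(1 + q) * x) * (‖V x‖ ^ 2 + ‖P x‖ ^ 2) with hE
  have hrexp : ∀ x : ℝ, HasDerivAt (fun x : ℝ => Real.exp (-(1 + q) * x))
      (Real.exp (-(1 + q) * x) * -(1 + q)) x := fun x => by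
    simpa using ((hasDerivAt_id x).const_mul (-(1 + q))).exp
  have hEd : ∀ x ∈ Icc (0:ℝ) 1, HasDerivWithinAt E _ (Icc (0:ℝ) 1) x := fun x hx =>
    (hrexp x).hasDerivWithinAt.mul ((hVd x hx).norm_sq.add (hPd x hx).norm_sq)
  have hanti : AntitoneOn E (Icc (0:ℝ) 1) := by
    refine antitoneOn_of_hasDerivWithinAt_nonpos (convex_Icc 0 1)
      (fun x hx => (hEd x hx).continuousWithinAt)
      (fun x hx => (hEd x (interior_subset hx)).mono interior_subset) fun x hx => ?_
    have hx' := interior_subset hx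
    have e1 : inner ℝ (V x) (-2 * (z * V x) + P x)
        = -2 * z.re * ‖V x‖ ^ 2 + inner ℝ (V x) (P x) := by
      rw [inner_add_right, ← Complex.normSq_eq_norm_sq]
      congr 1
      simp [Complex.inner, Complex.normSq_apply]
      ring
    have e2 : inner ℝ (P x) ((Q x : ℂ) * V x) ≤ q * (‖P x‖ * ‖V x‖) := by
      refine (real_inner_le_norm _ _).trans ?_
      rw [norm_mul (Q x : ℂ), Complex.norm_real, Real.norm_eq_abs]
      nlinarith [hq x hx', mul_nonneg (norm_nonneg (P x)) (norm_nonneg (V x))]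
    have e3 := real_inner_le_norm (V x) (P x)
    have e4 : 0 ≤ z.re * ‖V x‖ ^ 2 := by positivity
    have e5 : 0 ≤ (1 + q) * (‖V x‖ - ‖P x‖) ^ 2 := by positivity
    rw [e1, mul_assoc, ← mul_add]
    refine mul_nonpos_of_nonneg_of_nonpos (Real.exp_pos _).le ?_
    nlinarith
  have hle := hanti (left_mem_Icc.2 zero_le_one) (right_mem_Icc.2 zero_le_one) zero_le_one
  have hE0 : E 0 = 1 := by simp [hE, hV, hP, h0, h0']
  have hV1 : ‖V 1‖ ^ 2 ≤ Real.exp (1 + q) := by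
    rw [hE0] at hle
    have : E 1 * Real.exp (1 + q) = ‖V 1‖ ^ 2 + ‖P 1‖ ^ 2 := by
      simp only [hE]
      rw [mul_right_comm, ← Real.exp_add]
      simp
    nlinarith [Real.exp_pos (1 + q), sq_nonneg ‖P 1‖]
  have hV1' : ‖V 1‖ ≤ Real.exp (1 + q) := by
    have : 1 ≤ Real.exp (1 + q) := Real.one_le_exp (by linarith)
    nlinarith [norm_nonneg (V 1)]
  have hv1 : v 1 = Complex.exp z * V 1 := by
    simp only [hV]
    rw [← mul_assoc, ← Complex.exp_add]
    simp
  rw [hv1, norm_mul, Complex.norm_exp]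
  gcongr

/-- Schwarz lemma on the right half-plane, for a function vanishing at `a > 0`. -/
theorem norm_le_of_bounded_rightHalfPlane {G : ℂ → ℂ} {C : ℝ}
    (hG : DifferentiableOn ℂ G {z | 0 < z.re}) (hC : ∀ z : ℂ, 0 < z.re → ‖G z‖ ≤ C)
    {a : ℝ} (ha : 0 < a) (hGa : G a = 0) {z : ℂ} (hz : 0 < z.re) :
    ‖G z‖ ≤ C * ‖(z - a) / (z + a)‖ := by
  have hza : z + a ≠ 0 := fun h => by
    have := congrArg Complex.re h
    simp at this; linarith
  have hne : ∀ w ∈ ball (0:ℂ) 1, 1 - w ≠ 0 := fun w hw h => by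
    rw [sub_eq_zero] at h
    simp [← h] at hw
  have hmaps : MapsTo (fun w : ℂ => a * ((1 + w) / (1 - w))) (ball 0 1) {z | 0 < z.re} := by
    intro w hw
    have h1 := hne w hw
    have h2 : 0 < Complex.normSq (1 - w) := Complex.normSq_pos.2 h1
    have h3 : Complex.normSq w < 1 := by
      rw [mem_ball_zero_iff] at hw
      rw [Complex.normSq_eq_norm_sq]
      nlinarith [norm_nonneg w]
    have : ((a : ℂ) * ((1 + w) / (1 - w))).re
        = a * ((1 - Complex.normSq w) / Complex.normSq (1 - w)) := by
      rw [Complex.re_ofReal_mul, Complex.div_re]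
      simp [Complex.normSq_apply]
      left
      ring
    change 0 < ((a : ℂ) * ((1 + w) / (1 - w))).re
    rw [this]
    have := sub_pos.2 h3
    positivity
  have hd : DifferentiableOn ℂ (fun w : ℂ => G (a * ((1 + w) / (1 - w)))) (ball 0 1) := by
    refine hG.comp (fun w hw => ?_) hmaps
    have := hne w hw
    exact DifferentiableAt.differentiableWithinAt (by fun_prop (disch := assumption))
  have hw : (z - a) / (z + a) ∈ ball (0:ℂ) 1 := by
    rw [mem_ball_zero_iff, norm_div, div_lt_one (norm_pos_iff.2 hza),
      ← sq_lt_sq₀ (norm_nonneg _) (norm_nonneg _), ← Complex.normSq_eq_norm_sq,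
      ← Complex.normSq_eq_norm_sq]
    simp [Complex.normSq_apply]
    nlinarith [mul_pos ha hz]
  have key := Complex.dist_le_div_mul_dist_of_mapsTo_ball (R₂ := C) hd
    (fun w hw => by simpa [hGa] using hC _ (hmaps hw)) hw
  have hback : (a : ℂ) * ((1 + (z - a) / (z + a)) / (1 - (z - a) / (z + a))) = z := by
    have ha' : (a : ℂ) ≠ 0 := by exact_mod_cast ha.ne'
    have e1 : 1 + (z - a) / (z + a) = 2 * z / (z + a) := by field_simp; ring
    have e2 : 1 - (z - a) / (z + a) = 2 * a / (z + a) := by field_simp; ring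
    rw [e1, e2]
    field_simp
  simpa [hback, hGa] using key

/-- A bounded holomorphic function on the right half-plane is dominated by the finite Blaschke
product of its positive real zeros. -/
theorem norm_le_blaschke_prod {C : ℝ} {a : ℕ → ℝ} (ha : ∀ k, 0 < a k)
    (hinj : Function.Injective a) (n : ℕ) {G : ℂ → ℂ}
    (hG : DifferentiableOn ℂ G {z | 0 < z.re}) (hC : ∀ z : ℂ, 0 < z.re → ‖G z‖ ≤ C)
    (hGa : ∀ k < n, G (a k) = 0) {z : ℂ} (hz : 0 < z.re) :
    ‖G z‖ ≤ C * ∏ k ∈ Finset.range n, ‖(z - a k) / (z + a k)‖ := by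
  induction n generalizing G z with
  | zero => simpa using hC z hz
  | succ n ih =>
    have hopen : IsOpen {z : ℂ | 0 < z.re} := isOpen_lt continuous_const Complex.continuous_re
    have hmem : {z : ℂ | 0 < z.re} ∈ 𝓝 (a n : ℂ) := hopen.mem_nhds (by simpa using ha n)
    have hadd : ∀ w : ℂ, 0 < w.re → w + a n ≠ 0 := fun w hw h => by
      have := congrArg Complex.re h
      simp at this; linarith [ha n]
    set H : ℂ → ℂ := fun w => (w + a n) * dslope G (a n) w with hH
    have hHd : DifferentiableOn ℂ H {z | 0 < z.re} :=
      (by fun_prop : Differentiable ℂ fun w : ℂ => w + a n).differentiableOn.mul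
        ((Complex.differentiableOn_dslope hmem).2 hG)
    have hHeq : ∀ w : ℂ, G w * (w + a n) = (w - a n) * H w := fun w => by
      have := sub_smul_dslope G (a n : ℂ) w
      rw [hGa n n.lt_succ_self, sub_zero, smul_eq_mul] at this
      rw [← this]; simp only [hH]; ring
    have hHne : ∀ w : ℂ, 0 < w.re → w ≠ a n → ‖H w‖ ≤ C := fun w hw hwa => by
      have h1 := norm_le_of_bounded_rightHalfPlane hG hC (ha n) (hGa n n.lt_succ_self) hw
      have h2 := congrArg norm (hHeq w)
      rw [norm_mul, norm_mul] at h2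
      have h3 : 0 < ‖w - a n‖ := norm_pos_iff.2 (sub_ne_zero.2 hwa)
      have h4 : 0 < ‖w + a n‖ := norm_pos_iff.2 (hadd w hw)
      rw [norm_div, mul_div_assoc', le_div_iff₀ h4, h2] at h1
      exact le_of_mul_le_mul_left (by linarith) h3
    have hHC : ∀ w : ℂ, 0 < w.re → ‖H w‖ ≤ C := fun w hw => by
      by_cases hwa : w = a n
      · subst hwa
        have hcont : ContinuousAt (fun w => ‖H w‖) (a n : ℂ) :=
          (hHd.continuousOn.continuousAt hmem).norm
        refine le_of_tendsto (hcont.tendsto.mono_left (nhdsWithin_le_nhds (s := {(a n : ℂ)}ᶜ))) ?_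
        filter_upwards [nhdsWithin_le_nhds hmem, self_mem_nhdsWithin] with w h1 h2
        exact hHne w h1 h2
      · exact hHne w hw hwa
    have hHa : ∀ k < n, H (a k) = 0 := fun k hk => by
      have h1 := hHeq (a k)
      rw [hGa k (hk.trans n.lt_succ_self), zero_mul, eq_comm, mul_eq_zero] at h1
      refine h1.resolve_left fun h2 => hk.ne (hinj ?_)
      exact_mod_cast sub_eq_zero.1 h2
    have hGz : G z = H z * ((z - a n) / (z + a n)) := by
      have := hadd z hz
      field_simp
      rw [hHeq, mul_comm]
    rw [hGz, norm_mul, Finset.prod_range_succ, ← mul_assoc]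
    gcongr
    exact ih hHd hHC hHa hz

/-- A bounded holomorphic function on the right half-plane with positive real zeros `a k`
such that `∑ 1 / a k` diverges vanishes on the real points below all the zeros. -/
theorem eq_zero_of_not_summable_inv_zeros_s1 {C : ℝ} {a : ℕ → ℝ} (ha : ∀ k, 0 < a k)
    (hinj : Function.Injective a) (hdiv : ¬ Summable fun k => 1 / a k) {G : ℂ → ℂ}
    (hG : DifferentiableOn ℂ G {z | 0 < z.re}) (hC : ∀ z : ℂ, 0 < z.re → ‖G z‖ ≤ C)
    (hGa : ∀ k, G (a k) = 0) {x : ℝ} (hx : 0 < x) (hxa : ∀ k, x ≤ a k) : G x = 0 := by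
  have hfac : ∀ k, ‖((x : ℂ) - a k) / (x + a k)‖ ≤ Real.exp (-(x * (1 / a k))) := fun k => by
    have hak := ha k
    have hnorm : ‖((x : ℂ) - a k) / (x + a k)‖ = (a k - x) / (x + a k) := by
      rw [← Complex.ofReal_sub, ← Complex.ofReal_add, ← Complex.ofReal_div, Complex.norm_real,
        Real.norm_eq_abs, abs_div, abs_of_nonpos (sub_nonpos.2 (hxa k)),
        abs_of_pos (by positivity), neg_sub]
    rw [hnorm]
    refine le_trans ?_ (Real.add_one_le_exp _)
    rw [div_le_iff₀ (by positivity)]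
    field_simp
    nlinarith [hxa k]
  have hbound : ∀ n, ‖G x‖ ≤ C * Real.exp (-(x * ∑ k ∈ Finset.range n, 1 / a k)) := fun n => by
    have hC0 : 0 ≤ C := (norm_nonneg _).trans (hC x (by simpa using hx))
    refine (norm_le_blaschke_prod ha hinj n hG hC (fun k _ => hGa k)
      (by simpa using hx)).trans ?_
    rw [Finset.mul_sum, ← Finset.sum_neg_distrib, Real.exp_sum]
    gcongr with k
    exact hfac k
  have hsum := (not_summable_iff_tendsto_nat_atTop_of_nonneg
    (fun k => (one_div_pos.2 (ha k)).le)).1 hdiv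
  have hlim := (Real.tendsto_exp_neg_atTop_nhds_zero.comp
    (hsum.const_mul_atTop hx)).const_mul C
  rw [mul_zero] at hlim
  exact norm_le_zero_iff.1 (ge_of_tendsto' hlim hbound)

/-- If the characteristic functions `Δ_Q(μ) = s₀(1,μ)` of two continuous potentials agree
along a sequence of distinct positive reals `μ_k` with `Σ 1/√μ_k = ∞`, then they agree on
all of `ℂ`. -/
theorem characteristic_function_determined_by_sequence
    (Q Qt : ℝ → ℝ) (hQ : ContinuousOn Q (Icc (0:ℝ) 1)) (hQt : ContinuousOn Qt (Icc (0:ℝ) 1))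
    (S S' St St' : ℂ → ℝ → ℂ)
    (hS : ∀ μ : ℂ, IsSol Q μ (S μ) (S' μ) ∧ S μ 0 = 0 ∧ S' μ 0 = 1)
    (hSt : ∀ μ : ℂ, IsSol Qt μ (St μ) (St' μ) ∧ St μ 0 = 0 ∧ St' μ 0 = 1)
    (μk : ℕ → ℝ) (hpos : ∀ k, 0 < μk k) (hinj : Function.Injective μk)
    (hdiv : ¬ Summable (fun k => 1 / Real.sqrt (μk k)))
    (heq : ∀ k, S (↑(μk k)) 1 = St (↑(μk k)) 1) :
    ∀ μ : ℂ, S μ 1 = St μ 1 := by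
  have hdS := differentiable_characteristic hQ hS
  have hdSt := differentiable_characteristic hQt hSt
  obtain ⟨q, hq⟩ := isCompact_Icc.exists_bound_of_continuousOn hQ
  obtain ⟨qt, hqt⟩ := isCompact_Icc.exists_bound_of_continuousOn hQt
  have hfreq : ∃ᶠ μ in 𝓝[≠] (0 : ℂ), S μ 1 = St μ 1 := by
    rw [(nhdsWithin_basis_ball (x := (0 : ℂ))).frequently_iff]
    intro r hr
    suffices h : ∃ x : ℝ, 0 < x ∧ x < r ∧ S x 1 = St x 1 by
      obtain ⟨x, hx, hxr, h⟩ := h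
      exact ⟨x, ⟨by simpa [abs_of_pos hx] using hxr, by simpa using hx.ne'⟩, h⟩
    by_cases hinf : ∃ δ > 0, ∀ k, δ ≤ μk k
    · obtain ⟨δ, hδ, hδμ⟩ := hinf
      set t : ℝ := min δ (r / 2)
      have ht0 : 0 < t := by positivity
      refine ⟨t, ht0, (min_le_right _ _).trans_lt (by linarith), ?_⟩
      have hsq : ∀ y : ℝ, 0 ≤ y → ((√y : ℝ) : ℂ) ^ 2 = y := fun y hy => by
        rw [← Complex.ofReal_pow, Real.sq_sqrt hy]
      have hzero := eq_zero_of_not_summable_inv_zeros_s1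
        (G := fun z => (S (z ^ 2) 1 - St (z ^ 2) 1) * Complex.exp (-z))
        (C := Real.exp (1 + q) + Real.exp (1 + qt)) (a := fun k => √(μk k))
        (fun k => Real.sqrt_pos.2 (hpos k))
        (fun i j hij => hinj ((Real.sqrt_inj (hpos i).le (hpos j).le).1 hij)) hdiv
        (((hdS.comp (differentiable_id.pow 2)).sub
          (hdSt.comp (differentiable_id.pow 2))).mul (by fun_prop)).differentiableOn
        (fun z hz => by
          have b1 := norm_sol_sq_le hq hz.le (hS (z ^ 2)).1 (hS (z ^ 2)).2.1 (hS (z ^ 2)).2.2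
          have b2 := norm_sol_sq_le hqt hz.le (hSt (z ^ 2)).1 (hSt (z ^ 2)).2.1
            (hSt (z ^ 2)).2.2
          rw [norm_mul, Complex.norm_exp, Complex.neg_re, Real.exp_neg,
            mul_inv_le_iff₀ (Real.exp_pos _)]
          linarith [norm_sub_le (S (z ^ 2) 1) (St (z ^ 2) 1)])
        (fun k => by simp only [hsq _ (hpos k).le, heq k, sub_self, zero_mul])
        (Real.sqrt_pos.2 ht0)
        (fun k => Real.sqrt_le_sqrt ((min_le_left _ _).trans (hδμ k)))
      simp only [hsq t ht0.le] at hzero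
      exact sub_eq_zero.1 ((mul_eq_zero.1 hzero).resolve_right (Complex.exp_ne_zero _))
    · push Not at hinf
      obtain ⟨k, hk⟩ := hinf r hr
      exact ⟨μk k, hpos k, hk, heq k⟩
  exact congrFun (AnalyticOnNhd.eq_of_frequently_eq
    (fun z _ => hdS.analyticAt z) (fun z _ => hdSt.analyticAt z) hfreq)
end

section
/- Let Q, Q̃ : [0,1] → ℝ be continuous functions. Then Δ_Q(μ) = Δ_{Q̃}(μ) for all μ ∈ ℂ if and only if Q and Q̃ have exactly the same Dirichlet values, i.e. for every μ ∈ ℂ, μ is a Dirichlet value of Q if and only if μ is a Dirichlet value of Q̃. -/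
open Set

/-- `μ` is a Dirichlet value of `Q`: there is a nonzero solution of `-v'' + Q v = -μ v`
on `[0,1]` vanishing at both endpoints. -/
def IsDirichletValue (Q : ℝ → ℝ) (μ : ℂ) : Prop :=
  ∃ v v' : ℝ → ℂ, IsSol Q μ v v' ∧ v 0 = 0 ∧ v 1 = 0 ∧ ∃ x ∈ Icc (0:ℝ) 1, v x ≠ 0

theorem norm_le_of_forced_equation {q u u' g : ℝ → ℂ} {K ε δ : ℝ} (hK : 1 ≤ K)
    (hε : 0 ≤ ε)
    (hq : ∀ x ∈ Icc (0:ℝ) 1, ‖q x‖ ≤ K)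
    (hg : ∀ x ∈ Icc (0:ℝ) 1, ‖g x‖ ≤ ε)
    (hu : ∀ x ∈ Icc (0:ℝ) 1, HasDerivWithinAt u (u' x) (Icc (0:ℝ) 1) x)
    (hu' : ∀ x ∈ Icc (0:ℝ) 1, HasDerivWithinAt u' (q x * u x + g x) (Icc (0:ℝ) 1) x)
    (h0 : ‖u 0‖ ≤ δ) (h0' : ‖u' 0‖ ≤ δ) :
    ∀ x ∈ Icc (0:ℝ) 1, ‖u x‖ ≤ (δ + ε) * Real.exp K ∧ ‖u' x‖ ≤ (δ + ε) * Real.exp K := by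
  intro x hx
  have key := norm_le_gronwallBound_of_norm_deriv_right_le
    (f := fun t => (u t, u' t)) (f' := fun t => (u' t, q t * u t + g t)) (δ := δ) (K := K)
    (ε := ε) (a := 0) (b := 1)
    (fun t ht => ((hu t ht).prodMk (hu' t ht)).continuousWithinAt)
    (fun t ht => ((hu t (Ico_subset_Icc_self ht)).prodMk
      (hu' t (Ico_subset_Icc_self ht))).mono_of_mem_nhdsWithin (Icc_mem_nhdsGE_of_mem ht))
    (by simp [Prod.norm_def, h0, h0']) ?_ x hx
  · have hδ : 0 ≤ δ := (norm_nonneg _).trans h0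
    have hexp : Real.exp (K * (x - 0)) ≤ Real.exp K := by
      apply Real.exp_le_exp.2
      nlinarith [hx.2]
    have hone : 1 ≤ Real.exp (K * (x - 0)) := by
      apply Real.one_le_exp
      have := hx.1
      nlinarith
    have hdiv : ε / K ≤ ε := div_le_self hε hK
    have hdiv0 : 0 ≤ ε / K := by positivity
    have hb : gronwallBound δ K ε (x - 0) ≤ (δ + ε) * Real.exp K := by
      rw [gronwallBound_of_K_ne_0 (by positivity)]
      dsimp only
      nlinarith [mul_le_mul_of_nonneg_left hexp hδ, mul_le_mul_of_nonneg_left hexp hε,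
        mul_le_mul_of_nonneg_right hdiv (sub_nonneg.2 hone)]
    exact ⟨(norm_fst_le (u x, u' x)).trans (key.trans hb),
      (norm_snd_le (u x, u' x)).trans (key.trans hb)⟩
  · intro t ht
    have ht' := Ico_subset_Icc_self ht
    have h1 : ‖u t‖ ≤ ‖(u t, u' t)‖ := norm_fst_le (u t, u' t)
    have h2 : ‖u' t‖ ≤ ‖(u t, u' t)‖ := norm_snd_le (u t, u' t)
    have h3 := norm_nonneg (u t, u' t)
    refine max_le ?_ ?_
    · dsimp only
      nlinarith
    · calc ‖q t * u t + g t‖ ≤ ‖q t‖ * ‖u t‖ + ‖g t‖ := by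
            simpa using norm_add_le (q t * u t) (g t)
        _ ≤ K * ‖(u t, u' t)‖ + ε := by
            gcongr
            exacts [hq t ht', hg t ht']

theorem norm_ofReal_add_le {q M R : ℝ} {μ : ℂ} (hq : ‖q‖ ≤ M) (hμ : ‖μ‖ ≤ R) :
    ‖(q : ℂ) + μ‖ ≤ M + R + 1 := by
  have := norm_add_le (q : ℂ) μ
  rw [Complex.norm_real] at this
  linarith

theorem IsSol.norm_le_s2 {Q : ℝ → ℝ} {μ : ℂ} {v v' : ℝ → ℂ} (hv : IsSol Q μ v v') {M R δ : ℝ}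
    (hM : ∀ x ∈ Icc (0:ℝ) 1, ‖Q x‖ ≤ M) (hR : ‖μ‖ ≤ R) (h0 : ‖v 0‖ ≤ δ) (h0' : ‖v' 0‖ ≤ δ) :
    ∀ x ∈ Icc (0:ℝ) 1, ‖v x‖ ≤ δ * Real.exp (M + R + 1) ∧
      ‖v' x‖ ≤ δ * Real.exp (M + R + 1) := by
  have hM0 : 0 ≤ M := (norm_nonneg _).trans (hM 0 (by simp))
  have hR0 : 0 ≤ R := (norm_nonneg _).trans hR
  simpa using norm_le_of_forced_equation (q := fun x => (Q x : ℂ) + μ) (g := fun _ => 0)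
    (K := M + R + 1) (ε := 0) (by linarith) le_rfl
    (fun x hx => norm_ofReal_add_le (hM x hx) hR)
    (by simp) hv.1 (by simpa using hv.2) h0 h0'

theorem isDirichletValue_iff {Q : ℝ → ℝ} (hQ : ContinuousOn Q (Icc (0:ℝ) 1)) {μ : ℂ}
    {s s' : ℝ → ℂ} (hs : IsSol Q μ s s') (h0 : s 0 = 0) (h0' : s' 0 = 1) :
    IsDirichletValue Q μ ↔ s 1 = 0 := by
  constructor
  · rintro ⟨v, v', hv, hv0, hv1, x, hx, hvx⟩
    obtain ⟨M, hM⟩ := isCompact_Icc.exists_bound_of_continuousOn hQ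
    have hw : IsSol Q μ (fun x => v x - v' 0 * s x) (fun x => v' x - v' 0 * s' x) := by
      refine ⟨fun x hx => (hv.1 x hx).sub ((hs.1 x hx).const_mul _), fun x hx => ?_⟩
      exact ((hv.2 x hx).sub ((hs.2 x hx).const_mul _)).congr_deriv (by ring)
    have hz : ∀ x ∈ Icc (0:ℝ) 1, v x = v' 0 * s x := fun x hx => by
      have := (hw.norm_le_s2 (δ := 0) hM le_rfl (by simp [hv0, h0]) (by simp [h0']) x hx).1
      simpa [sub_eq_zero] using this
    have hne : v' 0 ≠ 0 := fun h => hvx (by simp [hz x hx, h])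
    have := hz 1 (by simp)
    rw [hv1] at this
    exact (mul_eq_zero.1 this.symm).resolve_left hne
  · intro h1
    refine ⟨s, s', hs, h0, h1, ?_⟩
    by_contra! hcon
    have hd : HasDerivWithinAt s 0 (Icc (0:ℝ) 1) 0 :=
      (hasDerivWithinAt_const 0 (Icc (0:ℝ) 1) (0:ℂ)).congr hcon (hcon 0 (by simp))
    have := (uniqueDiffOn_Icc zero_lt_one 0 (by simp)).eq_deriv _ hd (hs.1 0 (by simp))
    rw [h0'] at this
    exact zero_ne_one this

/-- `S μ` is, for every `μ`, the solution of `v'' = (Q + μ) v` with `v 0 = 0` and `v' 0 = 1`. -/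
def IsSineFamily (Q : ℝ → ℝ) (S S' : ℂ → ℝ → ℂ) : Prop :=
  ∀ μ : ℂ, IsSol Q μ (S μ) (S' μ) ∧ S μ 0 = 0 ∧ S' μ 0 = 1

namespace IsSineFamily

variable {Q : ℝ → ℝ} {S S' : ℂ → ℝ → ℂ} {M : ℝ}

theorem norm_le_s2 (hS : IsSineFamily Q S S') (hM : ∀ x ∈ Icc (0:ℝ) 1, ‖Q x‖ ≤ M) {R : ℝ} {μ : ℂ}
    (hμ : ‖μ‖ ≤ R) : ∀ x ∈ Icc (0:ℝ) 1,
      ‖S μ x‖ ≤ Real.exp (M + R + 1) ∧ ‖S' μ x‖ ≤ Real.exp (M + R + 1) := by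
  simpa using (hS μ).1.norm_le_s2 (δ := 1) hM hμ (by simp [(hS μ).2.1]) (by simp [(hS μ).2.2])

theorem norm_sub_le (hS : IsSineFamily Q S S') (hM : ∀ x ∈ Icc (0:ℝ) 1, ‖Q x‖ ≤ M) {R : ℝ}
    {μ ν : ℂ} (hμ : ‖μ‖ ≤ R) (hν : ‖ν‖ ≤ R) : ∀ x ∈ Icc (0:ℝ) 1,
      ‖S μ x - S ν x‖ ≤ ‖μ - ν‖ * Real.exp (M + R + 1) * Real.exp (M + R + 1) := by
  have hM0 : 0 ≤ M := (norm_nonneg _).trans (hM 0 (by simp))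
  have hR0 : 0 ≤ R := (norm_nonneg _).trans hμ
  intro x hx
  have := norm_le_of_forced_equation (q := fun x => (Q x : ℂ) + μ)
    (u := fun x => S μ x - S ν x) (u' := fun x => S' μ x - S' ν x)
    (g := fun x => (μ - ν) * S ν x) (K := M + R + 1) (δ := 0)
    (ε := ‖μ - ν‖ * Real.exp (M + R + 1)) (by linarith) (by positivity)
    (fun x hx => norm_ofReal_add_le (hM x hx) hμ)
    (fun x hx => by
      rw [norm_mul]
      gcongr
      exact (hS.norm_le_s2 hM hν x hx).1)
    (fun x hx => ((hS μ).1.1 x hx).sub ((hS ν).1.1 x hx))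
    (fun x hx => (((hS μ).1.2 x hx).sub ((hS ν).1.2 x hx)).congr_deriv (by ring))
    (by simp [(hS μ).2.1, (hS ν).2.1]) (by simp [(hS μ).2.2, (hS ν).2.2]) x hx
  simpa using this.1

theorem norm_slope_sub_slope_le (hS : IsSineFamily Q S S')
    (hM : ∀ x ∈ Icc (0:ℝ) 1, ‖Q x‖ ≤ M) {R : ℝ} {μ ν ξ : ℂ} (hμ : ‖μ‖ ≤ R) (hν : ‖ν‖ ≤ R)
    (hξ : ‖ξ‖ ≤ R) (hνμ : ν ≠ μ) (hξμ : ξ ≠ μ) :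
    ‖slope (fun μ => S μ 1) μ ν - slope (fun μ => S μ 1) μ ξ‖ ≤
      ‖ν - ξ‖ * Real.exp (M + R + 1) * Real.exp (M + R + 1) * Real.exp (M + R + 1) := by
  have hM0 : 0 ≤ M := (norm_nonneg _).trans (hM 0 (by simp))
  have hR0 : 0 ≤ R := (norm_nonneg _).trans hμ
  have hν' := sub_ne_zero.2 hνμ
  have hξ' := sub_ne_zero.2 hξμ
  have := norm_le_of_forced_equation (q := fun x => (Q x : ℂ) + μ)
    (u := fun x => (ν - μ)⁻¹ * (S ν x - S μ x) - (ξ - μ)⁻¹ * (S ξ x - S μ x))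
    (u' := fun x => (ν - μ)⁻¹ * (S' ν x - S' μ x) - (ξ - μ)⁻¹ * (S' ξ x - S' μ x))
    (g := fun x => S ν x - S ξ x) (K := M + R + 1) (δ := 0)
    (ε := ‖ν - ξ‖ * Real.exp (M + R + 1) * Real.exp (M + R + 1)) (by linarith) (by positivity)
    (fun x hx => norm_ofReal_add_le (hM x hx) hμ)
    (hS.norm_sub_le hM hν hξ)
    (fun x hx => ((((hS ν).1.1 x hx).sub ((hS μ).1.1 x hx)).const_mul _).sub
      ((((hS ξ).1.1 x hx).sub ((hS μ).1.1 x hx)).const_mul _))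
    (fun x hx => (((((hS ν).1.2 x hx).sub ((hS μ).1.2 x hx)).const_mul _).sub
      ((((hS ξ).1.2 x hx).sub ((hS μ).1.2 x hx)).const_mul _)).congr_deriv
        (by field_simp; ring))
    (by simp [(hS μ).2.1, (hS ν).2.1, (hS ξ).2.1])
    (by simp [(hS μ).2.2, (hS ν).2.2, (hS ξ).2.2]) 1 (by simp)
  simpa [slope] using this.1

theorem differentiable (hS : IsSineFamily Q S S') (hM : ∀ x ∈ Icc (0:ℝ) 1, ‖Q x‖ ≤ M) :
    Differentiable ℂ fun μ => S μ 1 := by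
  intro μ
  set R := ‖μ‖ + 1
  set C := Real.exp (M + R + 1)
  have hball : ∀ ν ∈ Metric.ball μ 1, ‖ν‖ ≤ R := fun ν hν => by
    have h1 : ‖ν - μ‖ < 1 := by simpa [dist_eq_norm] using hν
    have h2 := norm_le_norm_add_norm_sub' ν μ
    linarith
  have hlip : LipschitzOnWith (C * C * C).toNNReal (slope (fun μ => S μ 1) μ)
      (Metric.ball μ 1 \ {μ}) := by
    refine LipschitzOnWith.of_dist_le_mul fun ν hν ξ hξ => ?_
    rw [Real.coe_toNNReal _ (by positivity), dist_eq_norm, dist_eq_norm]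
    refine (hS.norm_slope_sub_slope_le hM (R := R) (by simp [R]) (hball ν hν.1) (hball ξ hξ.1)
      hν.2 hξ.2).trans (le_of_eq (by ring))
  have hcauchy : Cauchy (Filter.map (slope (fun μ => S μ 1) μ) (nhdsWithin μ {μ}ᶜ)) := by
    refine Cauchy.map_of_le (cauchy_nhds.mono inf_le_left) hlip.uniformContinuousOn ?_
    rw [Filter.le_principal_iff, sdiff_eq]
    exact Filter.inter_mem (mem_nhdsWithin_of_mem_nhds (Metric.ball_mem_nhds μ one_pos))
      self_mem_nhdsWithin
  obtain ⟨d, hd⟩ := CompleteSpace.complete hcauchy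
  exact (hasDerivAt_iff_tendsto_slope.2 hd).differentiableAt

/-- Since `Im (s' * conj s)` has derivative `Im μ * ‖s‖ ^ 2`, the characteristic function is bounded
below by a multiple of `|Im μ|`; hence its zeros are real and simple. -/
theorem exists_pos_mul_abs_im_le_norm (hS : IsSineFamily Q S S')
    (hM : ∀ x ∈ Icc (0:ℝ) 1, ‖Q x‖ ≤ M) {R : ℝ} (hR : 0 ≤ R) :
    ∃ c > 0, ∀ μ : ℂ, ‖μ‖ ≤ R → c * |μ.im| ≤ ‖S μ 1‖ := by
  have hM0 : 0 ≤ M := (norm_nonneg _).trans (hM 0 (by simp))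
  set K := M + R + 1
  set B := Real.exp K
  have hK : 1 ≤ K := by simp only [K]; linarith
  have hB : 1 ≤ B := Real.one_le_exp (by linarith)
  set δ := (2 * (K * B))⁻¹
  have hδ : 0 < δ := by positivity
  have hKB : K * B * δ = 1 / 2 := by simp only [δ]; field_simp
  have hδ1 : δ ≤ 1 := inv_le_one_of_one_le₀ (by nlinarith)
  refine ⟨δ ^ 3 / (12 * B), by positivity, fun μ hμ => ?_⟩
  have hsub : Icc (0:ℝ) δ ⊆ Icc 0 1 := Icc_subset_Icc_right hδ1
  have hs := (hS μ).1
  have hs0 := (hS μ).2.1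
  have hs0' := (hS μ).2.2
  have hbd := hS.norm_le_s2 hM hμ
  have hs' : ∀ t ∈ Icc (0:ℝ) δ, ‖S' μ t - 1‖ ≤ 1 / 2 := fun t ht => by
    have := norm_image_sub_le_of_norm_deriv_le_segment' (C := K * B) hs.2
      (fun x hx => by
        have hx := Ico_subset_Icc_self hx
        rw [norm_mul]
        gcongr
        exacts [norm_ofReal_add_le (hM x hx) hμ, (hbd x hx).1]) t (hsub ht)
    rw [hs0', sub_zero] at this
    exact this.trans (by rw [← hKB]; gcongr; exact ht.2)
  have hlow : ∀ t ∈ Icc (0:ℝ) δ, t / 2 ≤ ‖S μ t‖ := fun t ht => by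
    have := norm_image_sub_le_of_norm_deriv_le_segment' (f := fun t => S μ t - (t : ℂ))
      (f' := fun t => S' μ t - 1) (a := 0) (b := δ) (C := 1 / 2)
      (fun x hx => ((hs.1 x (hsub hx)).mono hsub).sub
        (Complex.ofRealCLM.hasDerivAt (x := x)).hasDerivWithinAt)
      (fun x hx => hs' x (Ico_subset_Icc_self hx)) t ht
    simp only [hs0, Complex.ofReal_zero, sub_zero] at this
    have h2 := norm_sub_norm_le (t : ℂ) (S μ t)
    rw [Complex.norm_real, Real.norm_of_nonneg ht.1, norm_sub_rev] at h2
    linarith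
  set E : ℝ → ℝ := fun t =>
    μ.im * ((S' μ t).im * (S μ t).re - (S' μ t).re * (S μ t).im) with hE
  have hE' : ∀ t ∈ Icc (0:ℝ) 1, HasDerivWithinAt E (μ.im ^ 2 * ‖S μ t‖ ^ 2) (Icc 0 1) t := by
    intro t ht
    have h1 := hs.1 t ht
    have h2 := hs.2 t ht
    have re1 := Complex.reCLM.hasFDerivAt.comp_hasDerivWithinAt t h1
    have im1 := Complex.imCLM.hasFDerivAt.comp_hasDerivWithinAt t h1
    have re2 := Complex.reCLM.hasFDerivAt.comp_hasDerivWithinAt t h2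
    have im2 := Complex.imCLM.hasFDerivAt.comp_hasDerivWithinAt t h2
    refine (((im2.mul re1).sub (re2.mul im1)).const_mul μ.im).congr_deriv ?_
    simp only [Complex.sq_norm, Complex.normSq_apply, Complex.reCLM_apply, Complex.imCLM_apply,
      Complex.mul_re, Complex.mul_im, Complex.add_re, Complex.add_im, Complex.ofReal_re,
      Complex.ofReal_im, Function.comp_apply]
    ring
  have hmono : MonotoneOn E (Icc 0 1) :=
    monotoneOn_of_hasDerivWithinAt_nonneg (convex_Icc 0 1)
      (fun t ht => (hE' t ht).continuousWithinAt)
      (fun t ht => (hE' t (interior_subset ht)).mono interior_subset)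
      (fun t _ => by positivity)
  have hcubic : ∀ t ∈ Icc (0:ℝ) δ, HasDerivWithinAt (fun t => E t - μ.im ^ 2 / 12 * t ^ 3)
      (μ.im ^ 2 * ‖S μ t‖ ^ 2 - μ.im ^ 2 / 12 * (3 * t ^ 2)) (Icc 0 δ) t := fun t ht => by
    have := ((hasDerivAt_pow 3 t).const_mul (μ.im ^ 2 / 12)).hasDerivWithinAt (s := Icc 0 δ)
    exact (((hE' t (hsub ht)).mono hsub).sub this).congr_deriv (by norm_num)
  have hmono' : MonotoneOn (fun t => E t - μ.im ^ 2 / 12 * t ^ 3) (Icc 0 δ) :=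
    monotoneOn_of_hasDerivWithinAt_nonneg (convex_Icc 0 δ)
      (fun t ht => (hcubic t ht).continuousWithinAt)
      (fun t ht => (hcubic t (interior_subset ht)).mono interior_subset)
      (fun t ht => by
        have ht := interior_subset ht
        have h1 : (t / 2) ^ 2 ≤ ‖S μ t‖ ^ 2 := pow_le_pow_left₀ (by linarith [ht.1]) (hlow t ht) 2
        nlinarith [mul_le_mul_of_nonneg_left h1 (sq_nonneg μ.im)])
  have hEδ := hmono' ⟨le_rfl, hδ.le⟩ ⟨hδ.le, le_rfl⟩ hδ.le
  have hE1 := hmono ⟨hδ.le, hδ1⟩ ⟨zero_le_one, le_rfl⟩ hδ1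
  have hE0 : E 0 = 0 := by simp [hE, hs0]
  have hEle : E 1 ≤ |μ.im| * (B * ‖S μ 1‖) := by
    have him : (S' μ 1).im * (S μ 1).re - (S' μ 1).re * (S μ 1).im =
        (S' μ 1 * (starRingEnd ℂ) (S μ 1)).im := by
      simp
      ring
    have hab := Complex.abs_im_le_norm (S' μ 1 * (starRingEnd ℂ) (S μ 1))
    rw [norm_mul, Complex.norm_conj] at hab
    refine (le_abs_self _).trans ?_
    simp only [hE]
    rw [abs_mul, him]
    gcongr
    refine hab.trans ?_
    gcongr
    exact (hbd 1 (by simp)).2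
  have hfinal : |μ.im| * (|μ.im| * δ ^ 3 / 12) ≤ |μ.im| * (B * ‖S μ 1‖) := by
    simp only [hE0] at hEδ
    rw [← sq_abs] at hEδ
    nlinarith
  rcases eq_or_ne μ.im 0 with h | h
  · simp [h]
  · have := le_of_mul_le_mul_left hfinal (abs_pos.2 h)
    rw [div_mul_eq_mul_div, div_le_iff₀ (by positivity)]
    linarith

theorem deriv_ne_zero (hS : IsSineFamily Q S S') (hM : ∀ x ∈ Icc (0:ℝ) 1, ‖Q x‖ ≤ M) {μ : ℂ}
    (hμ : S μ 1 = 0) : deriv (fun μ => S μ 1) μ ≠ 0 := by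
  intro hd
  obtain ⟨c, hc, hlow⟩ := hS.exists_pos_mul_abs_im_le_norm hM (R := ‖μ‖ + 1) (by positivity)
  have him : μ.im = 0 := by
    have := hlow μ (by linarith)
    rw [hμ, norm_zero] at this
    exact abs_eq_zero.1 (le_antisymm (by nlinarith) (abs_nonneg _))
  have hder := (hS.differentiable hM μ).hasDerivAt
  rw [hd, hasDerivAt_iff_isLittleO] at hder
  obtain ⟨r, hr, hball⟩ := Metric.eventually_nhds_iff.1 (hder.def (half_pos hc))
  set ε := min (r / 2) 1
  have hε : 0 < ε := by positivity
  have hεr : ε < r := (min_le_left _ _).trans_lt (by linarith)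
  have hnorm : ‖(ε : ℂ) * Complex.I‖ = ε := by simp [abs_of_pos hε]
  have h1 := hball (y := μ + ε * Complex.I) (by rwa [dist_eq_norm, add_sub_cancel_left, hnorm])
  have h2 := hlow (μ + ε * Complex.I)
    ((norm_add_le _ _).trans (by rw [hnorm]; gcongr; exact min_le_right _ _))
  rw [add_sub_cancel_left, hnorm, hμ, smul_zero, sub_zero, sub_zero] at h1
  simp only [Complex.add_im, him, Complex.mul_im, Complex.ofReal_re, Complex.I_im,
    Complex.ofReal_im, Complex.I_re, mul_one, mul_zero, add_zero, zero_add, abs_of_pos hε] at h2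
  nlinarith

end IsSineFamily

theorem Complex.sq_norm_sin (z : ℂ) :
    ‖Complex.sin z‖ ^ 2 = Real.sin z.re ^ 2 + Real.sinh z.im ^ 2 := by
  rw [Complex.sin_eq, Complex.sq_norm, Complex.normSq_apply]
  simp only [← Complex.ofReal_sin, ← Complex.ofReal_cos, ← Complex.ofReal_sinh,
    ← Complex.ofReal_cosh, ← Complex.ofReal_mul, Complex.add_re, Complex.add_im,
    Complex.ofReal_re, Complex.ofReal_im, Complex.mul_re, Complex.mul_im, Complex.I_re,
    Complex.I_im]
  nlinarith [Real.cosh_sq z.im, Real.sin_sq_add_cos_sq z.re]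

theorem Complex.norm_sin_le_exp_abs_im (z : ℂ) : ‖Complex.sin z‖ ≤ Real.exp |z.im| := by
  refine (abs_le_of_sq_le_sq' ?_ (Real.exp_pos _).le).2
  have h1 : Real.cosh z.im ≤ Real.exp |z.im| := by
    rw [← Real.cosh_abs, Real.cosh_eq]
    have : Real.exp (-|z.im|) ≤ Real.exp |z.im| :=
      Real.exp_le_exp.2 (by linarith [abs_nonneg z.im])
    linarith
  have h2 := pow_le_pow_left₀ (Real.cosh_pos z.im).le h1 2
  rw [Complex.sq_norm_sin]
  nlinarith [Real.cosh_sq z.im, Real.sin_sq_le_one z.re]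

theorem Complex.exp_abs_im_le_norm_sin {z : ℂ} (hz : Real.cos z.re = 0 ∨ 1 ≤ |z.im|) :
    Real.exp |z.im| / 4 ≤ ‖Complex.sin z‖ := by
  refine (abs_le_of_sq_le_sq' ?_ (norm_nonneg _)).2
  rw [Complex.sq_norm_sin]
  have he := Real.exp_pos |z.im|
  have he' := Real.exp_pos (-|z.im|)
  rcases hz with h | h
  · have h1 : Real.sin z.re ^ 2 + Real.sinh z.im ^ 2 = Real.cosh |z.im| ^ 2 := by
      rw [Real.cosh_abs, Real.cosh_sq, Real.sin_sq, h]
      ring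
    rw [h1, Real.cosh_eq]
    exact pow_le_pow_left₀ (by positivity) (by linarith) 2
  · have h1 : Real.sinh z.im ^ 2 = Real.sinh |z.im| ^ 2 := by rw [← sq_abs, Real.abs_sinh]
    have h2 : Real.exp (-|z.im|) ≤ Real.exp |z.im| / 2 := by
      have h3 : Real.exp (-|z.im|) ≤ 1 := by
        rw [Real.exp_le_one_iff]
        linarith
      have h4 := Real.add_one_le_exp |z.im|
      linarith
    rw [h1, Real.sinh_eq]
    have h5 : (Real.exp |z.im| / 4) ^ 2 ≤ ((Real.exp |z.im| - Real.exp (-|z.im|)) / 2) ^ 2 :=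
      pow_le_pow_left₀ (by positivity) (by linarith) 2
    linarith [sq_nonneg (Real.sin z.re)]

/-- Comparison with the zero potential: `s 1 = sin z / z + O(exp |Im z| / ‖z‖ ^ 2)`, where
`μ = -z ^ 2`. -/
theorem IsSol.norm_sub_sin_div_le {Q : ℝ → ℝ} {s s' : ℝ → ℂ} {z : ℂ} {M : ℝ}
    (hM : ∀ x ∈ Icc (0:ℝ) 1, ‖Q x‖ ≤ M) (hz : z ≠ 0) (hMz : 2 * M ≤ ‖z‖)
    (hs : IsSol Q (-z ^ 2) s s') (h0 : s 0 = 0) (h0' : s' 0 = 1) :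
    ‖s 1 - Complex.sin z / z‖ ≤ 2 * M * Real.exp |z.im| / ‖z‖ ^ 2 := by
  have hM0 : 0 ≤ M := (norm_nonneg _).trans (hM 0 (by simp))
  have hz0 : 0 < ‖z‖ := norm_pos_iff.2 hz
  have hsin : ∀ t : ℝ, 0 ≤ t → ‖Complex.sin (z * t)‖ ≤ Real.exp (|z.im| * t) := fun t ht => by
    have := Complex.norm_sin_le_exp_abs_im (z * t)
    simpa [abs_mul, abs_of_nonneg ht] using this
  obtain ⟨y, hy, hmax⟩ := isCompact_Icc.exists_isMaxOn (nonempty_Icc.2 zero_le_one)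
    (f := fun x => ‖s x‖ * Real.exp (-(|z.im| * x))) (s := Icc (0:ℝ) 1)
    ((show ContinuousOn s (Icc 0 1) from fun x hx => (hs.1 x hx).continuousWithinAt).norm.mul
      (by fun_prop))
  set H := ‖s y‖ * Real.exp (-(|z.im| * y)) with hH
  have hsH : ∀ x ∈ Icc (0:ℝ) 1, ‖s x‖ ≤ H * Real.exp (|z.im| * x) := fun x hx => by
    have : ‖s x‖ * Real.exp (-(|z.im| * x)) ≤ H := hmax hx
    rwa [Real.exp_neg, ← div_eq_mul_inv, div_le_iff₀ (Real.exp_pos _)] at this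
  have hH0 : 0 ≤ H := by positivity
  have key : ∀ x ∈ Icc (0:ℝ) 1, ‖s x - Complex.sin (z * x) / z‖ ≤
      M * H * Real.exp (|z.im| * x) / ‖z‖ := by
    intro x hx
    have hsub : Icc (0:ℝ) x ⊆ Icc 0 1 := Icc_subset_Icc_right hx.2
    have hlin : ∀ t : ℝ, HasDerivAt (fun t : ℝ => z * ((x - t : ℝ) : ℂ)) (-z) t := fun t => by
      have := ((hasDerivAt_id t).const_sub x).ofReal_comp.const_mul z
      exact this.congr_deriv (by simp)
    have hmv := norm_image_sub_le_of_norm_deriv_le_segment'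
      (f := fun t => s t * Complex.cos (z * ((x - t : ℝ) : ℂ)) +
        s' t * (Complex.sin (z * ((x - t : ℝ) : ℂ)) / z))
      (f' := fun t => Complex.sin (z * ((x - t : ℝ) : ℂ)) / z * (Q t * s t)) (a := 0) (b := x)
      (C := M * H * Real.exp (|z.im| * x) / ‖z‖)
      (fun t ht => by
        have hc := ((Complex.hasDerivAt_cos _).comp t (hlin t)).hasDerivWithinAt (s := Icc 0 x)
        have hn := (((Complex.hasDerivAt_sin _).comp t (hlin t)).div_const z).hasDerivWithinAt
          (s := Icc 0 x)
        have h1 := (hs.1 t (hsub ht)).mono hsub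
        have h2 := (hs.2 t (hsub ht)).mono hsub
        refine ((h1.mul hc).add (h2.mul hn)).congr_deriv ?_
        simp only [Function.comp_apply]
        field_simp
        ring)
      (fun t ht => by
        have ht := Ico_subset_Icc_self ht
        have hb : Real.exp (|z.im| * x) =
            Real.exp (|z.im| * (x - t)) * Real.exp (|z.im| * t) := by
          rw [← Real.exp_add]
          ring_nf
        rw [norm_mul, norm_div, norm_mul, Complex.norm_real, hb]
        calc ‖Complex.sin (z * ((x - t : ℝ) : ℂ))‖ / ‖z‖ * (‖Q t‖ * ‖s t‖)
            ≤ Real.exp (|z.im| * (x - t)) / ‖z‖ * (M * (H * Real.exp (|z.im| * t))) := by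
              gcongr
              exacts [hsin _ (sub_nonneg.2 ht.2), hM t (hsub ht), hsH t (hsub ht)]
          _ = _ := by ring) x ⟨hx.1, le_rfl⟩
    simp only [sub_self, sub_zero, Complex.ofReal_zero, mul_zero, Complex.cos_zero,
      Complex.sin_zero, zero_div, mul_one, add_zero, h0, h0', zero_mul, zero_add, one_mul] at hmv
    exact hmv.trans (mul_le_of_le_one_right (by positivity) hx.2)
  have hHle : H ≤ 2 / ‖z‖ := by
    have h1 := key y hy
    have h2 : ‖s y‖ ≤ (1 + M * H) * Real.exp (|z.im| * y) / ‖z‖ := by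
      have h3 := norm_le_norm_add_norm_sub' (s y) (Complex.sin (z * y) / z)
      have h4 : ‖Complex.sin (z * y) / z‖ ≤ Real.exp (|z.im| * y) / ‖z‖ := by
        rw [norm_div]
        gcongr
        exact hsin y hy.1
      calc ‖s y‖ ≤ Real.exp (|z.im| * y) / ‖z‖ + M * H * Real.exp (|z.im| * y) / ‖z‖ := by
            linarith
        _ = _ := by ring
    have h5 : H ≤ (1 + M * H) / ‖z‖ := by
      have h6 : H * Real.exp (|z.im| * y) = ‖s y‖ := by
        rw [hH, mul_assoc, ← Real.exp_add, neg_add_cancel, Real.exp_zero, mul_one]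
      refine le_of_mul_le_mul_right ?_ (Real.exp_pos (|z.im| * y))
      rw [h6]
      exact h2.trans (le_of_eq (by ring))
    rw [le_div_iff₀ hz0] at h5 ⊢
    nlinarith
  have h1 := key 1 (by simp)
  simp only [Complex.ofReal_one, mul_one] at h1
  calc _ ≤ M * H * Real.exp |z.im| / ‖z‖ := h1
    _ ≤ M * (2 / ‖z‖) * Real.exp |z.im| / ‖z‖ := by gcongr
    _ = _ := by field_simp

theorem exists_differentiable_eq_mul {f g : ℂ → ℂ} (hf : Differentiable ℂ f)
    (hg : Differentiable ℂ g) (hfg : ∀ μ, g μ = 0 → f μ = 0)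
    (hg' : ∀ μ, g μ = 0 → deriv g μ ≠ 0) :
    ∃ F : ℂ → ℂ, Differentiable ℂ F ∧ ∀ μ, f μ = F μ * g μ := by
  classical
  refine ⟨fun μ => if g μ = 0 then deriv f μ / deriv g μ else f μ / g μ, fun μ => ?_, fun μ => ?_⟩
  · by_cases hμ : g μ = 0
    · have hdslope : ∀ {h : ℂ → ℂ}, Differentiable ℂ h → Differentiable ℂ (dslope h μ) :=
        fun hh => differentiableOn_univ.1
          ((Complex.differentiableOn_dslope Filter.univ_mem).2 hh.differentiableOn)
      have hne : dslope g μ μ ≠ 0 := by simpa using hg' μ hμ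
      refine ((hdslope hf μ).div (hdslope hg μ) hne).congr_of_eventuallyEq ?_
      filter_upwards [(hdslope hg).continuous.continuousAt.eventually_ne hne] with ν hν
      rcases eq_or_ne ν μ with rfl | hνμ
      · simp [hμ]
      · have hsub := sub_ne_zero.2 hνμ
        have hgν : g ν ≠ 0 := fun h => hν (by simp [dslope_of_ne _ hνμ, slope, h, hμ])
        simp only [hgν, if_false, Pi.div_apply, dslope_of_ne _ hνμ, slope, hμ, hfg μ hμ,
          vsub_eq_sub, sub_zero, smul_eq_mul]
        field_simp
    · refine ((hf μ).div (hg μ) hμ).congr_of_eventuallyEq ?_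
      filter_upwards [hg.continuous.continuousAt.eventually_ne hμ] with ν hν
      simp [hν]
  · by_cases hμ : g μ = 0
    · simp [hμ, hfg μ hμ]
    · simp [hμ]


theorem Complex.mem_frontier_box {R : ℝ} (hR : 0 < R) {z : ℂ}
    (hz : z ∈ frontier (Ioo (-R) R ×ℂ Ioo (-R) R)) : |z.re| = R ∨ |z.im| = R := by
  have hlt : -R < R := by linarith
  rw [Complex.frontier_reProdIm, frontier_Ioo hlt] at hz
  rcases hz with hz | hz
  · have h := hz.2
    simp only [mem_preimage, mem_insert_iff, mem_singleton_iff] at h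
    exact Or.inr ((abs_eq hR.le).2 h.symm)
  · have h := hz.1
    simp only [mem_preimage, mem_insert_iff, mem_singleton_iff] at h
    exact Or.inl ((abs_eq hR.le).2 h.symm)

namespace IsSineFamily

variable {Q Qt : ℝ → ℝ} {S S' St St' : ℂ → ℝ → ℂ} {M : ℝ}

theorem norm_sub_one_le (hS : IsSineFamily Q S S') (hSt : IsSineFamily Qt St St')
    (hM : ∀ x ∈ Icc (0:ℝ) 1, ‖Q x‖ ≤ M) (hMt : ∀ x ∈ Icc (0:ℝ) 1, ‖Qt x‖ ≤ M)
    {z w : ℂ} (hz : 1 ≤ ‖z‖) (hMz : 16 * M ≤ ‖z‖)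
    (hcos : Real.cos z.re = 0 ∨ 1 ≤ |z.im|) (hw : S (-z ^ 2) 1 = w * St (-z ^ 2) 1) :
    ‖w - 1‖ ≤ 32 * M / ‖z‖ := by
  have hM0 : 0 ≤ M := (norm_nonneg _).trans (hM 0 (by simp))
  have hz0 : 0 < ‖z‖ := by linarith
  have hz' : z ≠ 0 := norm_pos_iff.1 hz0
  set e := Real.exp |z.im|
  have he : 0 < e := Real.exp_pos _
  have h1 := (hS (-z ^ 2)).1.norm_sub_sin_div_le hM hz' (by linarith) (hS _).2.1 (hS _).2.2
  have h2 := (hSt (-z ^ 2)).1.norm_sub_sin_div_le hMt hz' (by linarith) (hSt _).2.1 (hSt _).2.2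
  set f := S (-z ^ 2) 1
  set g := St (-z ^ 2) 1
  have hfg : ‖f - g‖ ≤ 4 * M * e / ‖z‖ ^ 2 := by
    have := norm_sub_le_norm_sub_add_norm_sub f (Complex.sin z / z) g
    rw [norm_sub_rev (Complex.sin z / z) g] at this
    calc _ ≤ 2 * M * e / ‖z‖ ^ 2 + 2 * M * e / ‖z‖ ^ 2 := by linarith
      _ = _ := by ring
  have hg : e / (8 * ‖z‖) ≤ ‖g‖ := by
    have h3 : e / 4 / ‖z‖ ≤ ‖Complex.sin z / z‖ := by
      rw [norm_div]
      gcongr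
      exact Complex.exp_abs_im_le_norm_sin hcos
    have h4 := norm_le_norm_add_norm_sub' (Complex.sin z / z) g
    rw [norm_sub_rev] at h4
    have h5 : 2 * M * e / ‖z‖ ^ 2 ≤ e / (8 * ‖z‖) := by
      rw [div_le_div_iff₀ (by positivity) (by positivity)]
      nlinarith [mul_le_mul_of_nonneg_left hMz (mul_pos he hz0).le]
    have h6 : e / 4 / ‖z‖ = e / (8 * ‖z‖) + e / (8 * ‖z‖) := by field_simp; norm_num
    linarith
  have hwg : ‖w - 1‖ * ‖g‖ ≤ 4 * M * e / ‖z‖ ^ 2 := by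
    rw [← norm_mul, sub_mul, one_mul, ← hw]
    exact hfg
  have h7 : ‖w - 1‖ * (e / (8 * ‖z‖)) ≤ 4 * M * e / ‖z‖ ^ 2 :=
    (mul_le_mul_of_nonneg_left hg (norm_nonneg _)).trans hwg
  rw [← le_div_iff₀ (by positivity)] at h7
  refine h7.trans (le_of_eq ?_)
  field_simp
  ring

theorem eq_of_zeros_subset (hS : IsSineFamily Q S S') (hSt : IsSineFamily Qt St St')
    (hM : ∀ x ∈ Icc (0:ℝ) 1, ‖Q x‖ ≤ M) (hMt : ∀ x ∈ Icc (0:ℝ) 1, ‖Qt x‖ ≤ M)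
    (hzero : ∀ μ, St μ 1 = 0 → S μ 1 = 0) (μ : ℂ) : S μ 1 = St μ 1 := by
  have hM0 : 0 ≤ M := (norm_nonneg _).trans (hM 0 (by simp))
  obtain ⟨F, hF, hSF⟩ := exists_differentiable_eq_mul (hS.differentiable hM)
    (hSt.differentiable hMt) hzero fun μ hμ => hSt.deriv_ne_zero hMt hμ
  obtain ⟨z, hz⟩ : ∃ z : ℂ, z ^ 2 = -μ := IsAlgClosed.exists_pow_nat_eq (-μ) two_pos
  have hbound : ∀ᶠ n : ℕ in Filter.atTop, ‖F μ - 1‖ ≤ 32 * M / ((n + 1 / 2) * Real.pi) := by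
    have hlim : Filter.Tendsto (fun n : ℕ => ((n : ℝ) + 1 / 2) * Real.pi) Filter.atTop
        Filter.atTop :=
      (Filter.tendsto_atTop_add_const_right _ _ tendsto_natCast_atTop_atTop).atTop_mul_const
        Real.pi_pos
    filter_upwards [hlim.eventually_ge_atTop 1, hlim.eventually_ge_atTop (16 * M),
      hlim.eventually_gt_atTop ‖z‖] with n h1 h2 h3
    set R := ((n : ℝ) + 1 / 2) * Real.pi with hR
    have hR0 : 0 < R := by linarith
    have hmax := Complex.norm_le_of_forall_mem_frontier_norm_le
      (U := Ioo (-R) R ×ℂ Ioo (-R) R) (f := fun z => F (-z ^ 2) - 1) (C := 32 * M / R) (z := z)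
      ((Metric.isBounded_Ioo _ _).reProdIm (Metric.isBounded_Ioo _ _))
      (Differentiable.diffContOnCl (by fun_prop)) ?_ (subset_closure ?_)
    · simpa [hz] using hmax
    · intro w hw
      have hcase := Complex.mem_frontier_box hR0 hw
      have hRw : R ≤ ‖w‖ := by
        rcases hcase with h | h
        · exact h ▸ Complex.abs_re_le_norm w
        · exact h ▸ Complex.abs_im_le_norm w
      refine (hS.norm_sub_one_le hSt hM hMt (by linarith) (by linarith) ?_ (hSF _)).trans ?_
      · rcases hcase with h | h
        · left
          rw [← Real.cos_abs, h, Real.cos_eq_zero_iff]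
          exact ⟨n, by rw [hR]; push_cast; ring⟩
        · exact Or.inr (h ▸ h1)
      · gcongr
    · have hre := abs_lt.1 ((Complex.abs_re_le_norm z).trans_lt h3)
      have him := abs_lt.1 ((Complex.abs_im_le_norm z).trans_lt h3)
      exact ⟨hre, him⟩
  have hlim : Filter.Tendsto (fun n : ℕ => 32 * M / (((n : ℝ) + 1 / 2) * Real.pi)) Filter.atTop
      (nhds 0) :=
    ((Filter.tendsto_atTop_add_const_right _ _ tendsto_natCast_atTop_atTop).atTop_mul_const
        Real.pi_pos).const_div_atTop _
  have hle := ge_of_tendsto hlim hbound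
  rw [hSF μ, sub_eq_zero.1 (norm_le_zero_iff.1 hle), one_mul]

end IsSineFamily

/-- The characteristic functions `Δ_Q(μ) = s₀(1,μ)` of two continuous potentials coincide
on all of `ℂ` iff the two potentials have exactly the same Dirichlet values. -/
theorem characteristic_eq_iff_isospectral
    (Q Qt : ℝ → ℝ) (hQ : ContinuousOn Q (Icc (0:ℝ) 1)) (hQt : ContinuousOn Qt (Icc (0:ℝ) 1))
    (S S' St St' : ℂ → ℝ → ℂ)
    (hS : ∀ μ : ℂ, IsSol Q μ (S μ) (S' μ) ∧ S μ 0 = 0 ∧ S' μ 0 = 1)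
    (hSt : ∀ μ : ℂ, IsSol Qt μ (St μ) (St' μ) ∧ St μ 0 = 0 ∧ St' μ 0 = 1) :
    (∀ μ : ℂ, S μ 1 = St μ 1) ↔ (∀ μ : ℂ, IsDirichletValue Q μ ↔ IsDirichletValue Qt μ) := by
  have h : ∀ μ, IsDirichletValue Q μ ↔ S μ 1 = 0 := fun μ =>
    isDirichletValue_iff hQ (hS μ).1 (hS μ).2.1 (hS μ).2.2
  have ht : ∀ μ, IsDirichletValue Qt μ ↔ St μ 1 = 0 := fun μ =>
    isDirichletValue_iff hQt (hSt μ).1 (hSt μ).2.1 (hSt μ).2.2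
  simp only [h, ht]
  refine ⟨fun heq μ => by rw [heq μ], fun hiff μ => ?_⟩
  obtain ⟨M, hM⟩ := isCompact_Icc.exists_bound_of_continuousOn hQ
  obtain ⟨Mt, hMt⟩ := isCompact_Icc.exists_bound_of_continuousOn hQt
  exact IsSineFamily.eq_of_zeros_subset (M := max M Mt) hS hSt
    (fun x hx => (hM x hx).trans (le_max_left _ _))
    (fun x hx => (hMt x hx).trans (le_max_right _ _)) (fun μ => (hiff μ).2) μ
end

section
/- Let Q : [0,1] → ℝ be continuous, let μ_k ∈ ℝ be a Dirichlet value of Q, and let φ : [0,1] → ℝ be a twice continuously differentiable function with φ''(x) = (Q(x) + μ_k)·φ(x) on [0,1], φ(0) = φ(1) = 0 and ∫_0^1 φ(s)² ds = 1. For t ∈ ℝ define θ_t : [0,1] → ℝ by θ_t(x) = 1 + (e^t - 1)·∫_x^1 φ(s)² ds, and define Q_t : [0,1] → ℝ by Q_t(x) = Q(x) - 2·(d²/dx²)(log θ_t)(x). Then θ_t(x) > 0 for all x ∈ [0,1], Q_t is continuous on [0,1], and for every μ ∈ ℂ, μ is a Dirichlet value of Q_t if and only if μ is a Dirichlet value of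 Q. -/
open Set

/-- Real-valued solution of `-v'' + Q v = -μ v` on `[0,1]`. -/
def IsSolR (Q : ℝ → ℝ) (μ : ℝ) (v v' : ℝ → ℝ) : Prop :=
  (∀ x ∈ Icc (0:ℝ) 1, HasDerivWithinAt v (v' x) (Icc (0:ℝ) 1) x) ∧
  (∀ x ∈ Icc (0:ℝ) 1, HasDerivWithinAt v' ((Q x + μ) * v x) (Icc (0:ℝ) 1) x)

/-- The function `u = v + c p F / θ`, with `F` a primitive of `p v`, where `p` solves the equation
at `μ₀` and `v` solves it at `μ ≠ μ₀`, solves the equation for the transformed potential. -/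
lemma IsSol.doubleCommutation {Q R : ℝ → ℝ} {μ₀ μ c : ℂ} {p p' θ v v' : ℝ → ℂ} (hμ : μ ≠ μ₀)
    (hp : IsSol Q μ₀ p p') (hv : IsSol Q μ v v')
    (hθ : ∀ x ∈ Icc (0:ℝ) 1, HasDerivWithinAt θ (-c * p x ^ 2) (Icc (0:ℝ) 1) x)
    (hθ0 : ∀ x ∈ Icc (0:ℝ) 1, θ x ≠ 0)
    (hR : ∀ x ∈ Icc (0:ℝ) 1,
      (R x : ℂ) = Q x + 4 * c * p x * p' x / θ x + 2 * c ^ 2 * p x ^ 4 / θ x ^ 2)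
    {F : ℝ → ℂ} (hF : ∀ x, F x = (p x * v' x - p' x * v x) / (μ - μ₀)) :
    (∀ x ∈ Icc (0:ℝ) 1, HasDerivWithinAt F (p x * v x) (Icc (0:ℝ) 1) x) ∧
    IsSol R μ (fun x => v x + c * p x * F x / θ x)
      (fun x => v' x + c * (p' x * F x + p x ^ 2 * v x) / θ x
        + c ^ 2 * p x ^ 3 * F x / θ x ^ 2) := by
  have hm : μ - μ₀ ≠ 0 := sub_ne_zero.mpr hμ
  have hF' : ∀ x ∈ Icc (0:ℝ) 1, HasDerivWithinAt F (p x * v x) (Icc (0:ℝ) 1) x := by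
    intro x hx
    rw [funext hF]
    refine ((((hp.1 x hx).mul (hv.2 x hx)).sub ((hp.2 x hx).mul (hv.1 x hx))).div_const
      (μ - μ₀)).congr_deriv ?_
    field_simp
    ring
  refine ⟨hF', fun x hx => ?_, fun x hx => ?_⟩
  · have h0 := hθ0 x hx
    refine ((hv.1 x hx).add ((((hp.1 x hx).const_mul c).mul (hF' x hx)).div
      (hθ x hx) h0)).congr_deriv ?_
    simp only [Pi.mul_apply]
    field_simp
    ring
  · have h0 := hθ0 x hx
    have hA := (((hp.2 x hx).mul (hF' x hx)).add
      (((hp.1 x hx).pow 2).mul (hv.1 x hx))).const_mul c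
    have hB := (((hp.1 x hx).pow 3).const_mul (c ^ 2)).mul (hF' x hx)
    refine (((hv.2 x hx).add (hA.div (hθ x hx) h0)).add
      (hB.div ((hθ x hx).pow 2) (pow_ne_zero 2 h0))).congr_deriv ?_
    simp only [Pi.mul_apply, Pi.add_apply, Pi.pow_apply]
    have hW : p x * v' x = (μ - μ₀) * F x + p' x * v x := by
      rw [hF x]
      field_simp
      ring
    rw [hR x hx]
    field_simp
    push_cast
    linear_combination (c * p x * θ x ^ 3) * hW

/-- If `p` solves the equation at `μ₀`, then `p / θ` solves it for the transformed potential. -/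
lemma IsSol.div_of_transform {Q R : ℝ → ℝ} {μ₀ c : ℂ} {p p' θ : ℝ → ℂ} (hp : IsSol Q μ₀ p p')
    (hθ : ∀ x ∈ Icc (0:ℝ) 1, HasDerivWithinAt θ (-c * p x ^ 2) (Icc (0:ℝ) 1) x)
    (hθ0 : ∀ x ∈ Icc (0:ℝ) 1, θ x ≠ 0)
    (hR : ∀ x ∈ Icc (0:ℝ) 1,
      (R x : ℂ) = Q x + 4 * c * p x * p' x / θ x + 2 * c ^ 2 * p x ^ 4 / θ x ^ 2) :
    IsSol R μ₀ (fun x => p x / θ x) (fun x => p' x / θ x + c * p x ^ 3 / θ x ^ 2) := by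
  refine ⟨fun x hx => ?_, fun x hx => ?_⟩
  · have h0 := hθ0 x hx
    refine ((hp.1 x hx).div (hθ x hx) h0).congr_deriv ?_
    field_simp
    ring
  · have h0 := hθ0 x hx
    refine (((hp.2 x hx).div (hθ x hx) h0).add ((((hp.1 x hx).pow 3).const_mul c).div
      ((hθ x hx).pow 2) (pow_ne_zero 2 h0))).congr_deriv ?_
    simp only [Pi.pow_apply]
    rw [hR x hx]
    field_simp
    push_cast
    ring

/-- Every Dirichlet value of `Q` is a Dirichlet value of the transformed potential. -/
lemma IsDirichletValue.transform {Q R : ℝ → ℝ} {μ₀ μ c : ℂ} {p p' θ : ℝ → ℂ}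
    (hp : IsSol Q μ₀ p p') (hp0 : p 0 = 0) (hp1 : p 1 = 0) (hpne : ∃ x ∈ Icc (0:ℝ) 1, p x ≠ 0)
    (hθ : ∀ x ∈ Icc (0:ℝ) 1, HasDerivWithinAt θ (-c * p x ^ 2) (Icc (0:ℝ) 1) x)
    (hθ0 : ∀ x ∈ Icc (0:ℝ) 1, θ x ≠ 0)
    (hR : ∀ x ∈ Icc (0:ℝ) 1,
      (R x : ℂ) = Q x + 4 * c * p x * p' x / θ x + 2 * c ^ 2 * p x ^ 4 / θ x ^ 2)
    (h : IsDirichletValue Q μ) : IsDirichletValue R μ := by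
  by_cases hμ : μ = μ₀
  · subst hμ
    obtain ⟨x, hx, hpx⟩ := hpne
    exact ⟨_, _, hp.div_of_transform hθ hθ0 hR, by simp [hp0], by simp [hp1],
      x, hx, div_ne_zero hpx (hθ0 x hx)⟩
  obtain ⟨v, v', hv, hv0, hv1, x, hx, hvx⟩ := h
  let F : ℝ → ℂ := fun x => (p x * v' x - p' x * v x) / (μ - μ₀)
  obtain ⟨hF, hu⟩ := hp.doubleCommutation hμ hv hθ hθ0 hR (F := F) fun _ => rfl
  refine ⟨_, _, hu, by simp [hp0, hv0], by simp [hp1, hv1], ?_⟩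
  by_contra! hu0
  have hconst : ∀ y ∈ Icc (0:ℝ) 1, HasDerivWithinAt (fun y => F y / θ y) 0 (Icc (0:ℝ) 1) y := by
    intro y hy
    have h0 := hθ0 y hy
    refine ((hF y hy).div (hθ y hy) h0).congr_deriv ?_
    have huy := hu0 y hy
    field_simp at huy ⊢
    linear_combination p y * huy
  have hFx : F x / θ x = F 0 / θ 0 := by
    refine constant_of_derivWithin_zero (fun y hy => (hconst y hy).differentiableWithinAt)
      (fun y hy => (hconst y (Ico_subset_Icc_self hy)).derivWithin
        (uniqueDiffOn_Icc zero_lt_one y (Ico_subset_Icc_self hy))) x hx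
  have hF0 : F 0 = 0 := by simp [F, hp0, hv0]
  rw [hF0, zero_div] at hFx
  apply hvx
  have hux := hu0 x hx
  rwa [mul_div_assoc, hFx, mul_zero, add_zero] at hux

/-- The transformed potential has the same Dirichlet values as `Q`. -/
lemma isDirichletValue_transform_iff {Q R : ℝ → ℝ} {μ₀ μ c : ℂ} {p p' θ : ℝ → ℂ}
    (hp : IsSol Q μ₀ p p') (hp0 : p 0 = 0) (hp1 : p 1 = 0) (hpne : ∃ x ∈ Icc (0:ℝ) 1, p x ≠ 0)
    (hθ : ∀ x ∈ Icc (0:ℝ) 1, HasDerivWithinAt θ (-c * p x ^ 2) (Icc (0:ℝ) 1) x)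
    (hθ0 : ∀ x ∈ Icc (0:ℝ) 1, θ x ≠ 0)
    (hR : ∀ x ∈ Icc (0:ℝ) 1,
      (R x : ℂ) = Q x + 4 * c * p x * p' x / θ x + 2 * c ^ 2 * p x ^ 4 / θ x ^ 2) :
    IsDirichletValue R μ ↔ IsDirichletValue Q μ := by
  refine ⟨?_, IsDirichletValue.transform hp hp0 hp1 hpne hθ hθ0 hR⟩
  -- The inverse transform has data `p / θ`, `1 / θ` and `-c`.
  refine IsDirichletValue.transform (c := -c) (θ := fun x => (θ x)⁻¹)
    (hp.div_of_transform hθ hθ0 hR) (by simp [hp0]) (by simp [hp1]) ?_ (fun x hx => ?_)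
    (fun x hx => inv_ne_zero (hθ0 x hx)) (fun x hx => ?_)
  · obtain ⟨x, hx, hpx⟩ := hpne
    exact ⟨x, hx, div_ne_zero hpx (hθ0 x hx)⟩
  · have h0 := hθ0 x hx
    refine ((hθ x hx).inv h0).congr_deriv ?_
    field_simp
  · have h0 := hθ0 x hx
    rw [hR x hx]
    field_simp
    ring

lemma IsSolR.ofReal {Q : ℝ → ℝ} {μ : ℝ} {v v' : ℝ → ℝ} (h : IsSolR Q μ v v') :
    IsSol Q μ (fun x => (v x : ℂ)) (fun x => (v' x : ℂ)) :=
  ⟨fun x hx => (h.1 x hx).ofReal_comp,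
    fun x hx => (h.2 x hx).ofReal_comp.congr_deriv (by push_cast; rfl)⟩

/-- The derivative, within an interval, of an integral as a function of its lower endpoint. -/
lemma ContinuousOn.hasDerivWithinAt_integral_left {f : ℝ → ℝ} {a b x : ℝ}
    (hf : ContinuousOn f (Icc a b)) (hx : x ∈ Icc a b) :
    HasDerivWithinAt (fun y => ∫ s in y..b, f s) (-f x) (Icc a b) x := by
  have : Fact (x ∈ Icc a b) := ⟨hx⟩
  refine intervalIntegral.integral_hasDerivWithinAt_left (t := Icc a b) ?_ ?_ (hf x hx)
  · refine (hf.mono ?_).intervalIntegrable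
    rw [uIcc_of_le hx.2]
    exact Icc_subset_Icc_left hx.1
  · exact hf.stronglyMeasurableAtFilter_nhdsWithin measurableSet_Icc x

/-- The Pöschel–Trubowitz explicit one-parameter family: given a normalized Dirichlet
eigenfunction `φ` of `Q` at the Dirichlet value `μ_k`, the function
`θ_t(x) = 1 + (e^t - 1)·∫_x^1 φ²` is positive on `[0,1]`, and the potential
`Q_t = Q - 2 (log θ_t)''` is continuous on `[0,1]` and has exactly the same Dirichlet
values as `Q`. -/
theorem poschel_trubowitz_isospectral_family
    (Q : ℝ → ℝ) (hQ : ContinuousOn Q (Icc (0:ℝ) 1))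
    (μk : ℝ) (hμk : IsDirichletValue Q (↑μk))
    (φ φ' : ℝ → ℝ) (hφ : IsSolR Q μk φ φ') (hφ0 : φ 0 = 0) (hφ1 : φ 1 = 0)
    (hnorm : (∫ s in (0:ℝ)..1, φ s ^ 2) = 1) (t : ℝ) :
    let θ : ℝ → ℝ := fun x => 1 + (Real.exp t - 1) * ∫ s in x..(1:ℝ), φ s ^ 2
    let Qt : ℝ → ℝ := fun x =>
      Q x - 2 * derivWithin
        (fun y => derivWithin (fun z => Real.log (θ z)) (Icc (0:ℝ) 1) y) (Icc (0:ℝ) 1) x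
    (∀ x ∈ Icc (0:ℝ) 1, 0 < θ x) ∧ ContinuousOn Qt (Icc (0:ℝ) 1) ∧
      ∀ μ : ℂ, IsDirichletValue Qt μ ↔ IsDirichletValue Q μ := by
  intro θ Qt
  set c := Real.exp t - 1
  have hφc : ContinuousOn φ (Icc 0 1) := fun x hx => (hφ.1 x hx).continuousWithinAt
  have hφc' : ContinuousOn φ' (Icc 0 1) := fun x hx => (hφ.2 x hx).continuousWithinAt
  have hθ : ∀ x ∈ Icc (0:ℝ) 1, HasDerivWithinAt θ (-c * φ x ^ 2) (Icc (0:ℝ) 1) x := by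
    intro x hx
    refine ((((hφc.pow 2).hasDerivWithinAt_integral_left hx).const_mul c).const_add
      1).congr_deriv ?_
    simp
  have hpos : ∀ x ∈ Icc (0:ℝ) 1, 0 < θ x := by
    intro x hx
    have h0 : 0 ≤ ∫ s in x..(1:ℝ), φ s ^ 2 :=
      intervalIntegral.integral_nonneg hx.2 fun s _ => sq_nonneg _
    have h0' : 0 ≤ ∫ s in (0:ℝ)..x, φ s ^ 2 :=
      intervalIntegral.integral_nonneg hx.1 fun s _ => sq_nonneg _
    have hadd : (∫ s in (0:ℝ)..x, φ s ^ 2) + ∫ s in x..(1:ℝ), φ s ^ 2 = 1 := by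
      refine (intervalIntegral.integral_add_adjacent_intervals ?_ ?_).trans hnorm
      · refine ((hφc.pow 2).mono ?_).intervalIntegrable
        rw [uIcc_of_le hx.1]
        exact Icc_subset_Icc_right hx.2
      · refine ((hφc.pow 2).mono ?_).intervalIntegrable
        rw [uIcc_of_le hx.2]
        exact Icc_subset_Icc_left hx.1
    have he := Real.exp_pos t
    change 0 < 1 + (Real.exp t - 1) * ∫ s in x..(1:ℝ), φ s ^ 2
    rcases h0.eq_or_lt with h | h
    · rw [← h]
      norm_num
    · linarith [mul_pos he h]
  have hlog : ∀ x ∈ Icc (0:ℝ) 1, derivWithin (fun z => Real.log (θ z)) (Icc (0:ℝ) 1) x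
      = -c * φ x ^ 2 / θ x := fun x hx =>
    ((hθ x hx).log (hpos x hx).ne').derivWithin (uniqueDiffOn_Icc zero_lt_one x hx)
  have hQt : ∀ x ∈ Icc (0:ℝ) 1,
      Qt x = Q x + 4 * c * φ x * φ' x / θ x + 2 * c ^ 2 * φ x ^ 4 / θ x ^ 2 := by
    intro x hx
    have h0 := (hpos x hx).ne'
    have h2 := ((((hφ.1 x hx).pow 2).const_mul (-c)).div (hθ x hx) h0).derivWithin
      (uniqueDiffOn_Icc zero_lt_one x hx)
    change Q x - 2 * derivWithin
      (fun y => derivWithin (fun z => Real.log (θ z)) (Icc (0:ℝ) 1) y) (Icc (0:ℝ) 1) x = _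
    rw [derivWithin_congr hlog (hlog x hx)]
    refine (congrArg (fun d => Q x - 2 * d) h2).trans ?_
    simp only [Pi.pow_apply]
    field_simp
    push_cast
    ring
  refine ⟨hpos, ?_, fun μ => ?_⟩
  · have hθc : ContinuousOn θ (Icc 0 1) := fun x hx => (hθ x hx).continuousWithinAt
    have hne : ∀ x ∈ Icc (0:ℝ) 1, θ x ≠ 0 := fun x hx => (hpos x hx).ne'
    refine ContinuousOn.congr ?_ hQt
    exact (hQ.add (((continuousOn_const.mul hφc).mul hφc').div hθc hne)).add
      ((continuousOn_const.mul (hφc.pow 4)).div (hθc.pow 2) fun x hx => pow_ne_zero 2 (hne x hx))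
  · refine isDirichletValue_transform_iff (c := (c : ℂ)) (θ := fun x => (θ x : ℂ)) hφ.ofReal
      (by simp [hφ0]) (by simp [hφ1]) ?_ (fun x hx => ?_)
      (fun x hx => Complex.ofReal_ne_zero.mpr (hpos x hx).ne') (fun x hx => ?_)
    · by_contra! hzero
      have : (∫ s in (0:ℝ)..1, φ s ^ 2) = ∫ s in (0:ℝ)..1, (0:ℝ) := by
        refine intervalIntegral.integral_congr fun s hs => ?_
        rw [uIcc_of_le zero_le_one] at hs
        simp [Complex.ofReal_eq_zero.mp (hzero s hs)]
      simp [hnorm] at this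
    · exact (hθ x hx).ofReal_comp.congr_deriv (by push_cast; rfl)
    · rw [hQt x hx]
      push_cast
      rfl
end

section
/- Let λ ≥ 0, let p > 1 be a real number, and let a, b > 0. Then there exists a twice continuously differentiable function w : [0,1] → ℝ such that w(x) > 0 for all x ∈ [0,1], w''(x) + λ·(w(x) - w(x)^p) = 0 for all x ∈ [0,1], w(0) = a, w(1) = b, and min(a,b,1) ≤ w(x) ≤ max(a,b,1) for all x ∈ [0,1]. -/
open Set

open scoped NNReal

/-- **Shooting method.** The two-point boundary value problem `w'' = g(w)`, `w(0) = a`, `w(1) = b`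
has a solution whenever `g` is Lipschitz and bounded. -/
theorem exists_solution_two_point_boundary_of_lipschitzWith_of_bounded
    {g : ℝ → ℝ} {K C : ℝ≥0} (hg : LipschitzWith K g) (hC : ∀ y, |g y| ≤ C) (a b : ℝ) :
    ∃ w v : ℝ → ℝ,
      (∀ x ∈ Icc (0 : ℝ) 1, HasDerivWithinAt w (v x) (Icc 0 1) x) ∧
      (∀ x ∈ Icc (0 : ℝ) 1, HasDerivWithinAt v (g (w x)) (Icc 0 1) x) ∧
      w 0 = a ∧ w 1 = b := by
  obtain ⟨S, hS⟩ : ∃ S : ℝ≥0, S = ‖b - a‖₊ + C := ⟨_, rfl⟩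
  have hS' : (S : ℝ) = |b - a| + C := by simp [hS]
  have hC0 : (0 : ℝ) ≤ C := C.2
  have hS0 : (0 : ℝ) ≤ S := S.2
  -- Truncating the velocity makes the vector field bounded; solutions never reach the truncation.
  let F : ℝ × ℝ → ℝ × ℝ := fun q ↦ (max (-(S + C : ℝ)) (min (S + C : ℝ) q.2), g q.1)
  have hF : LipschitzWith (max 1 (K * 1)) F :=
    ((LipschitzWith.prod_snd.const_min _).const_max _).prodMk (hg.comp LipschitzWith.prod_fst)
  have hFbound (q : ℝ × ℝ) : ‖F q‖ ≤ (S + C : ℝ≥0) := by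
    rw [Prod.norm_def, NNReal.coe_add]
    refine max_le ?_ ?_
    · rw [Real.norm_eq_abs, abs_le]
      exact ⟨le_max_left _ _, max_le (by linarith) (min_le_left _ _)⟩
    · exact (hC q.1).trans (by linarith)
  have hpl : IsPicardLindelof (fun _ : ℝ ↦ F) (⟨0, by simp⟩ : Icc (0 : ℝ) 1) (a, 0)
      (S + C + S) S (S + C) (max 1 (K * 1)) :=
    { lipschitzOnWith := fun _ _ ↦ hF.lipschitzOnWith
      continuousOn := fun _ _ ↦ continuousOn_const
      norm_le := fun _ _ q _ ↦ hFbound q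
      mul_max_le := by simp }
  obtain ⟨α, hα, L, hL⟩ := hpl.exists_forall_mem_closedBall_eq_hasDerivWithinAt_lipschitzOnWith
  have hmem (s : ℝ) (hs : s ∈ Icc (-S : ℝ) S) : (a, s) ∈ Metric.closedBall ((a, 0) : ℝ × ℝ) S := by
    simpa [Prod.dist_eq, abs_le] using hs
  have hpos (s : ℝ) (hs : s ∈ Icc (-S : ℝ) S) (t : ℝ) (ht : t ∈ Icc (0 : ℝ) 1) :
      HasDerivWithinAt (fun t ↦ (α (a, s) t).1) (F (α (a, s) t)).1 (Icc 0 1) t :=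
    (ContinuousLinearMap.fst ℝ ℝ ℝ).hasFDerivAt.comp_hasDerivWithinAt t
      ((hα _ (hmem s hs)).2 t ht)
  have hvel (s : ℝ) (hs : s ∈ Icc (-S : ℝ) S) (t : ℝ) (ht : t ∈ Icc (0 : ℝ) 1) :
      HasDerivWithinAt (fun t ↦ (α (a, s) t).2) (g (α (a, s) t).1) (Icc 0 1) t :=
    (ContinuousLinearMap.snd ℝ ℝ ℝ).hasFDerivAt.comp_hasDerivWithinAt t
      ((hα _ (hmem s hs)).2 t ht)
  have hinit (s : ℝ) (hs : s ∈ Icc (-S : ℝ) S) : α (a, s) 0 = (a, s) := (hα _ (hmem s hs)).1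
  have hvelbound (s : ℝ) (hs : s ∈ Icc (-S : ℝ) S) (t : ℝ) (ht : t ∈ Icc (0 : ℝ) 1) :
      |(α (a, s) t).2 - s| ≤ C := by
    have h := norm_image_sub_le_of_norm_deriv_le_segment' (hvel s hs) (fun _ _ ↦ hC _) t ht
    simp only [hinit s hs, Real.norm_eq_abs, sub_zero] at h
    exact h.trans (mul_le_of_le_one_right hC0 ht.2)
  have huntrunc (s : ℝ) (hs : s ∈ Icc (-S : ℝ) S) (t : ℝ) (ht : t ∈ Icc (0 : ℝ) 1) :
      (F (α (a, s) t)).1 = (α (a, s) t).2 := by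
    have h := abs_le.1 (hvelbound s hs t ht)
    have h1 : (α (a, s) t).2 ≤ S + C := by linarith [hs.2]
    have h2 : -(S + C : ℝ) ≤ (α (a, s) t).2 := by linarith [hs.1]
    simp only [F, min_eq_right h1, max_eq_right h2]
  have hend (s : ℝ) (hs : s ∈ Icc (-S : ℝ) S) : |(α (a, s) 1).1 - s - a| ≤ C := by
    have h := norm_image_sub_le_of_norm_deriv_le_segment_01'
      (f := fun t ↦ (α (a, s) t).1 - t * s) (f' := fun t ↦ (F (α (a, s) t)).1 - 1 * s) (C := C)
      (fun t ht ↦ (hpos s hs t ht).sub ((hasDerivWithinAt_id t _).mul_const s))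
      (fun t ht ↦ by
        rw [huntrunc s hs t (Ico_subset_Icc_self ht), one_mul]
        exact hvelbound s hs t (Ico_subset_Icc_self ht))
    simpa [hinit s hs] using h
  have hcont : ContinuousOn (fun s ↦ (α (a, s) 1).1) (Icc (-S : ℝ) S) :=
    continuous_fst.comp_continuousOn <|
      (hL 1 (by simp)).continuousOn.comp (by fun_prop) fun s hs ↦ hmem s hs
  have hSmem : (S : ℝ) ∈ Icc (-S : ℝ) S := ⟨by linarith, le_rfl⟩
  have hSmem' : (-S : ℝ) ∈ Icc (-S : ℝ) S := ⟨le_rfl, by linarith⟩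
  obtain ⟨s, hs, hsb⟩ := intermediate_value_Icc (by linarith) hcont
    (show b ∈ Icc _ _ from
      ⟨by linarith [(abs_le.1 (hend _ hSmem')).2, neg_abs_le (b - a)],
        by linarith [(abs_le.1 (hend _ hSmem)).1, le_abs_self (b - a)]⟩)
  refine ⟨fun t ↦ (α (a, s) t).1, fun t ↦ (α (a, s) t).2, fun t ht ↦ ?_, hvel s hs,
    by simp [hinit s hs], hsb⟩
  exact (hpos s hs t ht).congr_deriv (huntrunc s hs t ht)

/-- A function on `[0,1]` that is concave where it is below `m` and has boundary values at least
`m` is at least `m` everywhere. -/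
theorem le_of_second_deriv_nonpos_below {w v u : ℝ → ℝ} {m : ℝ}
    (hw : ∀ x ∈ Icc (0 : ℝ) 1, HasDerivWithinAt w (v x) (Icc 0 1) x)
    (hv : ∀ x ∈ Icc (0 : ℝ) 1, HasDerivWithinAt v (u x) (Icc 0 1) x)
    (hu : ∀ x ∈ Icc (0 : ℝ) 1, w x < m → u x ≤ 0) (h0 : m ≤ w 0) (h1 : m ≤ w 1)
    {x : ℝ} (hx : x ∈ Icc (0 : ℝ) 1) : m ≤ w x := by
  by_contra! hlt
  have hwc : ContinuousOn w (Icc 0 1) := HasDerivWithinAt.continuousOn hw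
  have hvc : ContinuousOn v (Icc 0 1) := HasDerivWithinAt.continuousOn hv
  obtain ⟨y, hy, hmin⟩ := isCompact_Icc.exists_isMinOn ⟨x, hx⟩ hwc
  have hym : w y < m := (hmin hx).trans_lt hlt
  have hy0 : 0 < y := hy.1.lt_of_ne (by rintro rfl; linarith)
  have hy1 : y < 1 := hy.2.lt_of_ne (by rintro rfl; linarith)
  have hnhds : Icc (0 : ℝ) 1 ∈ nhds y := Icc_mem_nhds hy0 hy1
  have hvy : v y = 0 := (hmin.isLocalMin hnhds).hasDerivAt_eq_zero ((hw y hy).hasDerivAt hnhds)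
  have hsub : Icc y 1 ⊆ Icc 0 1 := Icc_subset_Icc_left hy0.le
  -- `z` is the first point to the right of `y` where `w` reaches the level `m`.
  obtain ⟨z, ⟨hz, hzm⟩, hleast⟩ :
      ∃ z, IsLeast (Icc y 1 ∩ w ⁻¹' Ici m) z :=
    (isCompact_Icc.of_isClosed_subset
      ((hwc.mono hsub).preimage_isClosed_of_isClosed isClosed_Icc isClosed_Ici)
      inter_subset_left).exists_isLeast ⟨1, ⟨hy1.le, le_rfl⟩, h1⟩
  have hsub' : Icc y z ⊆ Icc 0 1 := Icc_subset_Icc hy0.le hz.2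
  have hint : interior (Icc y z) ⊆ Icc 0 1 := interior_subset.trans hsub'
  have hvanti : AntitoneOn v (Icc y z) := by
    refine antitoneOn_of_hasDerivWithinAt_nonpos (convex_Icc y z) (hvc.mono hsub')
      (fun t ht ↦ (hv t (hint ht)).mono hint) fun t ht ↦ hu t (hint ht) ?_
    rw [interior_Icc] at ht
    by_contra! htm
    exact ht.2.not_ge (hleast ⟨⟨ht.1.le, ht.2.le.trans hz.2⟩, htm⟩)
  have hwanti : AntitoneOn w (Icc y z) :=
    antitoneOn_of_hasDerivWithinAt_nonpos (convex_Icc y z) (hwc.mono hsub')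
      (fun t ht ↦ (hw t (hint ht)).mono hint) fun t ht ↦
        (hvanti (left_mem_Icc.2 hz.1) (interior_subset ht) (interior_subset ht).1).trans_eq hvy
  exact absurd ((hwanti (left_mem_Icc.2 hz.1) (right_mem_Icc.2 hz.1) hz.1).trans_lt hym)
    (not_lt.2 hzm)

/-- **Method of lower and upper solutions**, for constant lower and upper solutions `m ≤ M` of
`w'' = f(w)`. -/
theorem exists_solution_two_point_boundary_of_const_lower_upper
    {f : ℝ → ℝ} {K : ℝ≥0} {m M a b : ℝ} (hf : LipschitzOnWith K f (Icc m M))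
    (hfm : f m ≤ 0) (hfM : 0 ≤ f M) (ha : a ∈ Icc m M) (hb : b ∈ Icc m M) :
    ∃ w v : ℝ → ℝ,
      (∀ x ∈ Icc (0 : ℝ) 1, HasDerivWithinAt w (v x) (Icc 0 1) x) ∧
      (∀ x ∈ Icc (0 : ℝ) 1, HasDerivWithinAt v (f (w x)) (Icc 0 1) x) ∧
      w 0 = a ∧ w 1 = b ∧ ∀ x ∈ Icc (0 : ℝ) 1, w x ∈ Icc m M := by
  have hmM : m ≤ M := ha.1.trans ha.2
  have hclamp (y : ℝ) : max m (min M y) ∈ Icc m M :=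
    ⟨le_max_left _ _, max_le hmM (min_le_left _ _)⟩
  have hg : LipschitzWith (K * 1) (fun y ↦ f (max m (min M y))) := by
    rw [← lipschitzOnWith_univ]
    exact hf.comp (((LipschitzWith.id.const_min M).const_max m).lipschitzOnWith)
      fun y _ ↦ hclamp y
  obtain ⟨C, hC⟩ := isCompact_Icc.exists_bound_of_continuousOn hf.continuousOn
  obtain ⟨w, v, hw, hv, hw0, hw1⟩ :=
    exists_solution_two_point_boundary_of_lipschitzWith_of_bounded (C := C.toNNReal) hg
      (fun y ↦ (hC _ (hclamp y)).trans (Real.le_coe_toNNReal C)) a b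
  have hbd (x : ℝ) (hx : x ∈ Icc (0 : ℝ) 1) : w x ∈ Icc m M := by
    refine ⟨le_of_second_deriv_nonpos_below hw hv (fun t _ ht ↦ ?_) (hw0 ▸ ha.1) (hw1 ▸ hb.1) hx,
      neg_le_neg_iff.1 <| le_of_second_deriv_nonpos_below (fun t ht ↦ (hw t ht).neg)
        (fun t ht ↦ (hv t ht).neg) (fun t _ ht ↦ ?_) (neg_le_neg (hw0 ▸ ha.2))
        (neg_le_neg (hw1 ▸ hb.2)) hx⟩
    · rwa [max_eq_left ((min_le_right _ _).trans ht.le)]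
    · rw [min_eq_left (neg_lt_neg_iff.1 ht).le, max_eq_right hmM]
      exact neg_nonpos.2 hfM
  refine ⟨w, v, hw, fun x hx ↦ ?_, hw0, hw1, hbd⟩
  have h := hv x hx
  rwa [min_eq_right (hbd x hx).2, max_eq_right (hbd x hx).1] at h

/-- Existence of a positive solution of the one-dimensional Yamabe-type equation
`w'' + λ(w - w^p) = 0` on `[0,1]` with prescribed positive boundary values `a, b`,
pinched between the constants `min(a,b,1)` and `max(a,b,1)`. -/
theorem yamabe_type_ode_positive_solution
    (lam p a b : ℝ) (hlam : 0 ≤ lam) (hp : 1 < p) (ha : 0 < a) (hb : 0 < b) :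
    ∃ w w' : ℝ → ℝ,
      (∀ x ∈ Icc (0:ℝ) 1, HasDerivWithinAt w (w' x) (Icc (0:ℝ) 1) x) ∧
      (∀ x ∈ Icc (0:ℝ) 1,
        HasDerivWithinAt w' (-(lam * (w x - w x ^ p))) (Icc (0:ℝ) 1) x) ∧
      (∀ x ∈ Icc (0:ℝ) 1, 0 < w x) ∧
      w 0 = a ∧ w 1 = b ∧
      ∀ x ∈ Icc (0:ℝ) 1, min (min a b) 1 ≤ w x ∧ w x ≤ max (max a b) 1 := by
  obtain ⟨m, hm⟩ : ∃ m, m = min (min a b) 1 := ⟨_, rfl⟩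
  obtain ⟨M, hM⟩ : ∃ M, M = max (max a b) 1 := ⟨_, rfl⟩
  rw [← hm, ← hM]
  have hm0 : 0 < m := hm ▸ lt_min (lt_min ha hb) one_pos
  have hm1 : m ≤ 1 := hm ▸ min_le_right _ _
  have hM1 : 1 ≤ M := hM ▸ le_max_right _ _
  have hsmooth : ContDiffOn ℝ 1 (fun y : ℝ ↦ -(lam * (y - y ^ p))) (Icc m M) :=
    (contDiffOn_const.mul (contDiffOn_id.sub
      (contDiffOn_id.rpow_const_of_ne fun y hy ↦ (hm0.trans_le hy.1).ne'))).neg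
  obtain ⟨K, hK⟩ := hsmooth.exists_lipschitzOnWith one_ne_zero (convex_Icc m M) isCompact_Icc
  obtain ⟨w, v, hw, hv, hw0, hw1, hbd⟩ :=
    exists_solution_two_point_boundary_of_const_lower_upper (a := a) (b := b) hK
      (neg_nonpos.2 <| mul_nonneg hlam <| sub_nonneg.2 <|
        Real.rpow_le_self_of_le_one hm0.le hm1 hp.le)
      (neg_nonneg.2 <| mul_nonpos_of_nonneg_of_nonpos hlam <| sub_nonpos.2 <|
        Real.self_le_rpow_of_one_le hM1 hp.le)
      ⟨by simp [hm], by simp [hM]⟩ ⟨by simp [hm], by simp [hM]⟩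
  exact ⟨w, v, hw, hv, fun x hx ↦ hm0.trans_le (hbd x hx).1, hw0, hw1, hbd⟩
end

section
/- Let f : [0,1] × ℝ → ℝ be continuous and continuously differentiable in its second variable. Let w̲, w̄ : [0,1] → ℝ be twice continuously differentiable with w̲(x) ≤ w̄(x) for all x ∈ [0,1], w̲''(x) + f(x, w̲(x)) ≥ 0 for all x ∈ [0,1] (lower solution), and w̄''(x) + f(x, w̄(x)) ≤ 0 for all x ∈ [0,1] (upper solution). Let a, b ∈ ℝ satisfy w̲(0) ≤ a ≤ w̄(0) and w̲(1) ≤ b ≤ w̄(1). Then there exists a twice continuously differentiable function w : [0,1] → ℝ with w''(x) + f(x, w(x)) = 0 for all x ∈ [0,1], w(0) = a, w(1) = b, and w̲(x) ≤ w(x) ≤ w̄(x) for all x ∈ [0,1]. -/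
open Set Filter Topology MeasureTheory

/-- Maximum principle: a supersolution of `u'' = c u` with `c > 0` that is nonnegative at the
endpoints is nonnegative. -/
theorem nonneg_of_second_deriv_le {u u' u'' : ℝ → ℝ} {c : ℝ} (hc : 0 < c)
    (hu : ∀ x ∈ Icc (0 : ℝ) 1, HasDerivWithinAt u (u' x) (Icc (0 : ℝ) 1) x)
    (hu' : ∀ x ∈ Icc (0 : ℝ) 1, HasDerivWithinAt u' (u'' x) (Icc (0 : ℝ) 1) x)
    (hle : ∀ x ∈ Icc (0 : ℝ) 1, u'' x ≤ c * u x) (h0 : 0 ≤ u 0) (h1 : 0 ≤ u 1) :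
    ∀ x ∈ Icc (0 : ℝ) 1, 0 ≤ u x := by
  have hcont : ContinuousOn u (Icc (0 : ℝ) 1) := fun x hx => (hu x hx).continuousWithinAt
  obtain ⟨z, hz, hmin⟩ := isCompact_Icc.exists_isMinOn (nonempty_Icc.2 zero_le_one) hcont
  intro x hx
  by_contra! hneg
  have huz : u z < 0 := (hmin hx).trans_lt hneg
  have hz0 : 0 < z := lt_of_le_of_ne hz.1 (by rintro rfl; linarith)
  have hz1 : z < 1 := lt_of_le_of_ne hz.2 (by rintro rfl; linarith)
  have hnhds : ∀ᶠ y in 𝓝 z, Icc (0 : ℝ) 1 ∈ 𝓝 y :=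
    eventually_eventually_nhds.2 (Icc_mem_nhds hz0 hz1)
  have hderiv : deriv u =ᶠ[𝓝 z] u' :=
    hnhds.mono fun y hy => ((hu y (mem_of_mem_nhds hy)).hasDerivAt hy).deriv
  have hd2 : deriv (deriv u) z = u'' z := by
    rw [hderiv.deriv_eq]
    exact ((hu' z hz).hasDerivAt hnhds.self_of_nhds).deriv
  have hlocmin : IsLocalMin u z := hmin.isLocalMin hnhds.self_of_nhds
  have hu''z : u'' z < 0 := (hle z hz).trans_lt (mul_neg_of_pos_of_neg hc huz)
  have hlocmax : IsLocalMax u z := isLocalMax_of_deriv_deriv_neg (hd2 ▸ hu''z)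
    hlocmin.deriv_eq_zero ((hu z hz).hasDerivAt hnhds.self_of_nhds).continuousAt
  have hconst : u =ᶠ[𝓝 z] fun _ => u z := by
    filter_upwards [hlocmin, hlocmax] with y h₁ h₂ using le_antisymm h₂ h₁
  have : deriv (deriv u) z = 0 := by
    rw [hconst.deriv.deriv_eq]
    simp
  linarith

/-- The solution of `w'' = k² w - g` with vanishing Cauchy data at `0`. -/
noncomputable def cauchySolution (k : ℝ) (g : ℝ → ℝ) (x : ℝ) : ℝ :=
  (Real.exp (-(k * x)) * (∫ s in (0 : ℝ)..x, Real.exp (k * s) * g s) -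
    Real.exp (k * x) * ∫ s in (0 : ℝ)..x, Real.exp (-(k * s)) * g s) / (2 * k)

/-- The derivative of `cauchySolution`. -/
noncomputable def cauchySolutionDeriv (k : ℝ) (g : ℝ → ℝ) (x : ℝ) : ℝ :=
  -(Real.exp (-(k * x)) * (∫ s in (0 : ℝ)..x, Real.exp (k * s) * g s) +
    Real.exp (k * x) * ∫ s in (0 : ℝ)..x, Real.exp (-(k * s)) * g s) / 2

/-- The solution of `w'' = k² w - g` with boundary values `a` at `0` and `b` at `1`. -/
noncomputable def dirichletSolution (k a b : ℝ) (g : ℝ → ℝ) (x : ℝ) : ℝ :=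
  cauchySolution k g x + a * Real.cosh (k * x) +
    (b - cauchySolution k g 1 - a * Real.cosh k) / Real.sinh k * Real.sinh (k * x)

/-- The derivative of `dirichletSolution`. -/
noncomputable def dirichletSolutionDeriv (k a b : ℝ) (g : ℝ → ℝ) (x : ℝ) : ℝ :=
  cauchySolutionDeriv k g x + a * (k * Real.sinh (k * x)) +
    (b - cauchySolution k g 1 - a * Real.cosh k) / Real.sinh k * (k * Real.cosh (k * x))

section LinearProblem

variable {k : ℝ} {g : ℝ → ℝ}

theorem hasDerivAt_exp_const_mul (k x : ℝ) :
    HasDerivAt (fun x => Real.exp (k * x)) (k * Real.exp (k * x)) x := by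
  simpa [mul_comm] using ((hasDerivAt_id x).const_mul k).exp

theorem hasDerivAt_exp_neg_const_mul (k x : ℝ) :
    HasDerivAt (fun x => Real.exp (-(k * x))) (-k * Real.exp (-(k * x))) x := by
  simpa [mul_comm] using ((hasDerivAt_id x).const_mul k).neg.exp

theorem hasDerivAt_integral_of_continuous (hg : Continuous g) (x : ℝ) :
    HasDerivAt (fun x => ∫ s in (0 : ℝ)..x, g s) (g x) x :=
  (hg.integral_hasStrictDerivAt 0 x).hasDerivAt

theorem hasDerivAt_cauchySolution (hk : k ≠ 0) (hg : Continuous g) (x : ℝ) :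
    HasDerivAt (cauchySolution k g) (cauchySolutionDeriv k g x) x := by
  have h₁ := hasDerivAt_integral_of_continuous
    (show Continuous fun s => Real.exp (k * s) * g s by fun_prop) x
  have h₂ := hasDerivAt_integral_of_continuous
    (show Continuous fun s => Real.exp (-(k * s)) * g s by fun_prop) x
  refine ((((hasDerivAt_exp_neg_const_mul k x).mul h₁).sub
    ((hasDerivAt_exp_const_mul k x).mul h₂)).div_const (2 * k)).congr_deriv ?_
  unfold cauchySolutionDeriv
  field_simp
  ring

theorem hasDerivAt_cauchySolutionDeriv (hg : Continuous g) (x : ℝ) :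
    HasDerivAt (cauchySolutionDeriv k g) (k ^ 2 * cauchySolution k g x - g x) x := by
  have h₁ := hasDerivAt_integral_of_continuous
    (show Continuous fun s => Real.exp (k * s) * g s by fun_prop) x
  have h₂ := hasDerivAt_integral_of_continuous
    (show Continuous fun s => Real.exp (-(k * s)) * g s by fun_prop) x
  refine ((((hasDerivAt_exp_neg_const_mul k x).mul h₁).add
    ((hasDerivAt_exp_const_mul k x).mul h₂)).neg.div_const 2).congr_deriv ?_
  have hexp : Real.exp (-(k * x)) * Real.exp (k * x) = 1 := by
    rw [← Real.exp_add]; simp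
  unfold cauchySolution
  field_simp
  linear_combination (-2 * g x) * hexp

theorem hasDerivAt_dirichletSolution (hk : k ≠ 0) (a b : ℝ) (hg : Continuous g) (x : ℝ) :
    HasDerivAt (dirichletSolution k a b g) (dirichletSolutionDeriv k a b g x) x := by
  have hlin : HasDerivAt (fun x => k * x) k x := by simpa using (hasDerivAt_id x).const_mul k
  refine (((hasDerivAt_cauchySolution hk hg x).add (hlin.cosh.const_mul a)).add
    (hlin.sinh.const_mul _)).congr_deriv ?_
  unfold dirichletSolutionDeriv
  ring

theorem hasDerivAt_dirichletSolutionDeriv (a b : ℝ) (hg : Continuous g) (x : ℝ) :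
    HasDerivAt (dirichletSolutionDeriv k a b g)
      (k ^ 2 * dirichletSolution k a b g x - g x) x := by
  have hlin : HasDerivAt (fun x => k * x) k x := by simpa using (hasDerivAt_id x).const_mul k
  refine (((hasDerivAt_cauchySolutionDeriv hg x).add
    ((hlin.sinh.const_mul k).const_mul a)).add
    ((hlin.cosh.const_mul k).const_mul _)).congr_deriv ?_
  unfold dirichletSolution
  ring

theorem dirichletSolution_zero (k a b : ℝ) (g : ℝ → ℝ) : dirichletSolution k a b g 0 = a := by
  simp [dirichletSolution, cauchySolution]

theorem dirichletSolution_one (hk : k ≠ 0) (a b : ℝ) (g : ℝ → ℝ) :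
    dirichletSolution k a b g 1 = b := by
  have : Real.sinh k ≠ 0 := Real.sinh_ne_zero.2 hk
  simp only [dirichletSolution, mul_one]
  field_simp
  ring

theorem continuous_dirichletSolution (k a b : ℝ)
    (hg : ∀ c d : ℝ, IntervalIntegrable g volume c d) :
    Continuous (dirichletSolution k a b g) := by
  have h₁ : Continuous fun x => ∫ s in (0 : ℝ)..x, Real.exp (k * s) * g s :=
    intervalIntegral.continuous_primitive
      (fun c d => (hg c d).continuousOn_mul (by fun_prop)) 0
  have h₂ : Continuous fun x => ∫ s in (0 : ℝ)..x, Real.exp (-(k * s)) * g s :=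
    intervalIntegral.continuous_primitive
      (fun c d => (hg c d).continuousOn_mul (by fun_prop)) 0
  unfold dirichletSolution cauchySolution
  fun_prop

theorem tendsto_integral_mul_of_dominated {G : ℕ → ℝ → ℝ} {e bound : ℝ → ℝ}
    (he : Continuous e) (hG : ∀ n, Continuous (G n)) (hbound : Continuous bound)
    (hle : ∀ n s, |G n s| ≤ bound s) (hlim : ∀ s, Tendsto (fun n => G n s) atTop (𝓝 (g s)))
    (x : ℝ) :
    Tendsto (fun n => ∫ s in (0 : ℝ)..x, e s * G n s) atTop
      (𝓝 (∫ s in (0 : ℝ)..x, e s * g s)) := by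
  refine intervalIntegral.tendsto_integral_filter_of_dominated_convergence
    (fun s => |e s| * bound s) ?_ ?_ ?_ ?_
  · exact .of_forall fun n => (he.mul (hG n)).aestronglyMeasurable
  · refine .of_forall fun n => .of_forall fun s _ => ?_
    rw [Real.norm_eq_abs, abs_mul]
    exact mul_le_mul_of_nonneg_left (hle n s) (abs_nonneg _)
  · exact (he.abs.mul hbound).intervalIntegrable _ _
  · exact .of_forall fun s _ => (hlim s).const_mul _

theorem tendsto_dirichletSolution {G : ℕ → ℝ → ℝ} {bound : ℝ → ℝ} (k a b : ℝ)
    (hG : ∀ n, Continuous (G n)) (hbound : Continuous bound)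
    (hle : ∀ n s, |G n s| ≤ bound s) (hlim : ∀ s, Tendsto (fun n => G n s) atTop (𝓝 (g s)))
    (x : ℝ) :
    Tendsto (fun n => dirichletSolution k a b (G n) x) atTop
      (𝓝 (dirichletSolution k a b g x)) := by
  have hcauchy : ∀ y, Tendsto (fun n => cauchySolution k (G n) y) atTop
      (𝓝 (cauchySolution k g y)) := fun y =>
    (((tendsto_integral_mul_of_dominated (by fun_prop) hG hbound hle hlim y).const_mul _).sub
      ((tendsto_integral_mul_of_dominated (by fun_prop) hG hbound hle hlim y).const_mul
        _)).div_const _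
  exact ((hcauchy x).add_const _).add
    (((((hcauchy 1).const_sub b).sub_const _).div_const _).mul_const _)

theorem dirichletSolution_mono (hk : k ≠ 0) (a b : ℝ) {h : ℝ → ℝ} (hg : Continuous g)
    (hh : Continuous h) (hle : ∀ x, g x ≤ h x) {x : ℝ} (hx : x ∈ Icc (0 : ℝ) 1) :
    dirichletSolution k a b g x ≤ dirichletSolution k a b h x := by
  refine sub_nonneg.1 (nonneg_of_second_deriv_le (c := k ^ 2) (by positivity)
    (fun x _ => ((hasDerivAt_dirichletSolution hk a b hh x).sub
      (hasDerivAt_dirichletSolution hk a b hg x)).hasDerivWithinAt)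
    (fun x _ => ((hasDerivAt_dirichletSolutionDeriv a b hh x).sub
      (hasDerivAt_dirichletSolutionDeriv a b hg x)).hasDerivWithinAt)
    (fun x _ => ?_) ?_ ?_ x hx)
  · simp only [Pi.sub_apply]
    linarith [hle x]
  · simp [dirichletSolution_zero]
  · simp [dirichletSolution_one hk]

end LinearProblem

/-- Monotone iteration for `w'' = k² w - G(x, w)` with `G` increasing in its second variable and
bounded by continuous functions of `x`. -/
theorem exists_dirichlet_solution_of_monotone {k : ℝ} (hk : k ≠ 0) (a b : ℝ) {G : ℝ → ℝ → ℝ}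
    {lo hi : ℝ → ℝ} (hG : Continuous (Function.uncurry G)) (hmono : ∀ x, Monotone (G x))
    (hlo : Continuous lo) (hhi : Continuous hi) (hloG : ∀ x y, lo x ≤ G x y)
    (hGhi : ∀ x y, G x y ≤ hi x) :
    ∃ w w' : ℝ → ℝ,
      (∀ x ∈ Icc (0 : ℝ) 1, HasDerivWithinAt w (w' x) (Icc (0 : ℝ) 1) x) ∧
      (∀ x ∈ Icc (0 : ℝ) 1,
        HasDerivWithinAt w' (k ^ 2 * w x - G x (w x)) (Icc (0 : ℝ) 1) x) ∧
      w 0 = a ∧ w 1 = b := by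
  let p : ℝ → ℝ := fun x => projIcc (0 : ℝ) 1 zero_le_one x
  have hp : Continuous p := continuous_subtype_val.comp continuous_projIcc
  have hpmem : ∀ x, p x ∈ Icc (0 : ℝ) 1 := fun x => (projIcc (0 : ℝ) 1 zero_le_one x).2
  have hpid : ∀ x ∈ Icc (0 : ℝ) 1, p x = x := fun x hx => by
    simp [p, projIcc_of_mem zero_le_one hx]
  let T : (ℝ → ℝ) → ℝ → ℝ := fun g x => dirichletSolution k a b g (p x)
  have hTcont : ∀ {g}, Continuous g → Continuous (T g) := fun hg =>
    (continuous_dirichletSolution k a b fun c d => hg.intervalIntegrable c d).comp hp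
  have hTmono : ∀ {g h : ℝ → ℝ}, Continuous g → Continuous h → (∀ x, g x ≤ h x) →
      ∀ x, T g x ≤ T h x := fun hg hh hle x =>
    dirichletSolution_mono hk a b hg hh hle (hpmem x)
  have hGcomp : ∀ {v : ℝ → ℝ}, Continuous v → Continuous fun x => G x (v x) := fun hv =>
    hG.comp (continuous_id.prodMk hv)
  let v : ℕ → ℝ → ℝ := fun n => Nat.rec (T lo) (fun _ u => T fun x => G x (u x)) n
  have hvcont : ∀ n, Continuous (v n) := by
    intro n
    induction n with
    | zero => exact hTcont hlo
    | succ n ih => exact hTcont (hGcomp ih)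
  have hvstep : ∀ n x, v n x ≤ v (n + 1) x := by
    intro n
    induction n with
    | zero => exact hTmono hlo (hGcomp (hvcont 0)) fun x => hloG x _
    | succ n ih =>
      exact hTmono (hGcomp (hvcont n)) (hGcomp (hvcont (n + 1))) fun x => hmono x (ih x)
  have hvmono : ∀ x, Monotone fun n => v n x := fun x =>
    monotone_nat_of_le_succ fun n => hvstep n x
  have hvbdd : ∀ x, BddAbove (range fun n => v n x) := by
    refine fun x => ⟨T hi x, ?_⟩
    rintro _ ⟨n, rfl⟩
    exact (hvstep n x).trans (hTmono (hGcomp (hvcont n)) hhi (fun x => hGhi x _) x)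
  let w : ℝ → ℝ := fun x => ⨆ n, v n x
  have hlim : ∀ x, Tendsto (fun n => v n x) atTop (𝓝 (w x)) := fun x =>
    tendsto_atTop_ciSup (hvmono x) (hvbdd x)
  have hGbound : ∀ x y, |G x y| ≤ |lo x| + |hi x| := fun x y => by
    rw [abs_le]
    constructor
    · linarith [hloG x y, neg_abs_le (lo x), abs_nonneg (hi x)]
    · linarith [hGhi x y, le_abs_self (hi x), abs_nonneg (lo x)]
  have hbound : Continuous fun x => |lo x| + |hi x| := hlo.abs.add hhi.abs
  have hGlim : ∀ x, Tendsto (fun n => G x (v n x)) atTop (𝓝 (G x (w x))) := fun x =>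
    ((hG.comp (Continuous.prodMk_right x)).tendsto (w x)).comp (hlim x)
  have hfix : w = T fun x => G x (w x) := by
    funext x
    exact tendsto_nhds_unique ((tendsto_add_atTop_iff_nat 1).2 (hlim x))
      (tendsto_dirichletSolution k a b (fun n => hGcomp (hvcont n)) hbound
        (fun n s => hGbound s _) hGlim (p x))
  have hwmeas : Measurable fun x => G x (w x) :=
    measurable_of_tendsto_metrizable (fun n => (hGcomp (hvcont n)).measurable)
      (tendsto_pi_nhds.2 hGlim)
  have hwcont : Continuous w := by
    rw [hfix]
    refine (continuous_dirichletSolution k a b fun c d => ?_).comp hp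
    exact (hbound.intervalIntegrable c d).mono_fun' hwmeas.aestronglyMeasurable
      (.of_forall fun x => hGbound x _)
  have hGw := hGcomp hwcont
  have hweq : ∀ x ∈ Icc (0 : ℝ) 1, w x = dirichletSolution k a b (fun x => G x (w x)) x :=
    fun x hx => by
      rw [congrFun hfix x]
      simp only [T, hpid x hx]
  refine ⟨w, dirichletSolutionDeriv k a b fun x => G x (w x), fun x hx => ?_, fun x hx => ?_,
    ?_, ?_⟩
  · exact (hasDerivAt_dirichletSolution hk a b hGw x).hasDerivWithinAt.congr hweq (hweq x hx)
  · exact (hasDerivAt_dirichletSolutionDeriv a b hGw x).hasDerivWithinAt.congr_deriv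
      (by rw [← hweq x hx])
  · rw [hweq 0 (by simp), dirichletSolution_zero]
  · rw [hweq 1 (by simp), dirichletSolution_one hk]

/-- The method of lower and upper solutions for the nonlinear Dirichlet problem
`w'' + f(x,w) = 0` on `[0,1]`: given a lower solution `wl` and an upper solution `wu`
with `wl ≤ wu`, and boundary values pinched between them, there exists a solution `w`
with `wl ≤ w ≤ wu`. -/
theorem lower_upper_solutions
    (f fw : ℝ → ℝ → ℝ)
    (hf : Continuous (Function.uncurry f))
    (hfw : Continuous (Function.uncurry fw))
    (hfderiv : ∀ x y : ℝ, HasDerivAt (f x) (fw x y) y)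
    (wl wl' wl'' wu wu' wu'' : ℝ → ℝ)
    (hwl1 : ∀ x ∈ Icc (0:ℝ) 1, HasDerivWithinAt wl (wl' x) (Icc (0:ℝ) 1) x)
    (hwl2 : ∀ x ∈ Icc (0:ℝ) 1, HasDerivWithinAt wl' (wl'' x) (Icc (0:ℝ) 1) x)
    (hwl3 : ContinuousOn wl'' (Icc (0:ℝ) 1))
    (hwu1 : ∀ x ∈ Icc (0:ℝ) 1, HasDerivWithinAt wu (wu' x) (Icc (0:ℝ) 1) x)
    (hwu2 : ∀ x ∈ Icc (0:ℝ) 1, HasDerivWithinAt wu' (wu'' x) (Icc (0:ℝ) 1) x)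
    (hwu3 : ContinuousOn wu'' (Icc (0:ℝ) 1))
    (hle : ∀ x ∈ Icc (0:ℝ) 1, wl x ≤ wu x)
    (hlower : ∀ x ∈ Icc (0:ℝ) 1, 0 ≤ wl'' x + f x (wl x))
    (hupper : ∀ x ∈ Icc (0:ℝ) 1, wu'' x + f x (wu x) ≤ 0)
    (a b : ℝ) (ha : wl 0 ≤ a ∧ a ≤ wu 0) (hb : wl 1 ≤ b ∧ b ≤ wu 1) :
    ∃ w w' : ℝ → ℝ,
      (∀ x ∈ Icc (0:ℝ) 1, HasDerivWithinAt w (w' x) (Icc (0:ℝ) 1) x) ∧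
      (∀ x ∈ Icc (0:ℝ) 1, HasDerivWithinAt w' (-(f x (w x))) (Icc (0:ℝ) 1) x) ∧
      w 0 = a ∧ w 1 = b ∧
      ∀ x ∈ Icc (0:ℝ) 1, wl x ≤ w x ∧ w x ≤ wu x := by
  have hwlc : ContinuousOn wl (Icc (0:ℝ) 1) := fun x hx => (hwl1 x hx).continuousWithinAt
  have hwuc : ContinuousOn wu (Icc (0:ℝ) 1) := fun x hx => (hwu1 x hx).continuousWithinAt
  let p : ℝ → ℝ := fun x => projIcc (0 : ℝ) 1 zero_le_one x
  have hp : Continuous p := continuous_subtype_val.comp continuous_projIcc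
  have hpmem : ∀ x, p x ∈ Icc (0 : ℝ) 1 := fun x => (projIcc (0 : ℝ) 1 zero_le_one x).2
  have hpid : ∀ x ∈ Icc (0 : ℝ) 1, p x = x := fun x hx => by
    simp [p, projIcc_of_mem zero_le_one hx]
  have hL : Continuous fun x => wl (p x) := hwlc.comp_continuous hp hpmem
  have hU : Continuous fun x => wu (p x) := hwuc.comp_continuous hp hpmem
  have hLU : ∀ x, wl (p x) ≤ wu (p x) := fun x => hle _ (hpmem x)
  obtain ⟨m, hm⟩ := (isCompact_Icc.image_of_continuousOn hwlc).bddBelow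
  obtain ⟨M, hM⟩ := (isCompact_Icc.image_of_continuousOn hwuc).bddAbove
  obtain ⟨C, hC⟩ := ((isCompact_Icc (a := (0 : ℝ)) (b := 1)).prod
    (isCompact_Icc (a := m) (b := M))).exists_bound_of_continuousOn hfw.continuousOn
  let k : ℝ := |C| + 1
  have hk : k ≠ 0 := by positivity
  have hCk : C ≤ k ^ 2 := by
    have : (0 : ℝ) ≤ |C| := abs_nonneg C
    have := le_abs_self C
    simp only [k]
    nlinarith
  have hshift : ∀ x ∈ Icc (0 : ℝ) 1, MonotoneOn (fun y => f x y + k ^ 2 * y) (Icc m M) := by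
    intro x hx
    have hd : ∀ y, HasDerivAt (fun y => f x y + k ^ 2 * y) (fw x y + k ^ 2) y := fun y => by
      exact ((hfderiv x y).add ((hasDerivAt_id y).const_mul (k ^ 2))).congr_deriv (by simp)
    refine monotoneOn_of_deriv_nonneg (convex_Icc m M)
      (fun y _ => (hd y).continuousAt.continuousWithinAt)
      (fun y _ => (hd y).differentiableAt.differentiableWithinAt) fun y hy => ?_
    rw [(hd y).deriv]
    have := (abs_le.1 (hC (x, y) ⟨hx, interior_subset hy⟩)).1
    simp only [Function.uncurry_apply_pair] at this
    linarith
  let c : ℝ → ℝ → ℝ := fun x y => max (wl (p x)) (min (wu (p x)) y)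
  let F : ℝ → ℝ → ℝ := fun x y => f (p x) y + k ^ 2 * y
  have hFcont : ∀ {X : Type} [TopologicalSpace X] {s t : X → ℝ}, Continuous s → Continuous t →
      Continuous fun z => F (s z) (t z) := fun hs ht =>
    (hf.comp ((hp.comp hs).prodMk ht)).add (continuous_const.mul ht)
  have hF : ∀ x {y z : ℝ}, wl (p x) ≤ y → y ≤ z → z ≤ wu (p x) → F x y ≤ F x z := by
    intro x y z h₁ h₂ h₃
    have hmx : m ≤ wl (p x) := hm (mem_image_of_mem wl (hpmem x))
    have hMx : wu (p x) ≤ M := hM (mem_image_of_mem wu (hpmem x))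
    exact hshift _ (hpmem x) ⟨by linarith, by linarith⟩ ⟨by linarith, by linarith⟩ h₂
  have hcl : ∀ x y, wl (p x) ≤ c x y := fun x y => le_max_left _ _
  have hcu : ∀ x y, c x y ≤ wu (p x) := fun x y => max_le (hLU x) (min_le_left _ _)
  have hlo : ∀ x y, F x (wl (p x)) ≤ F x (c x y) := fun x y =>
    hF x le_rfl (hcl x y) (hcu x y)
  have hhi : ∀ x y, F x (c x y) ≤ F x (wu (p x)) := fun x y =>
    hF x (hcl x y) (hcu x y) le_rfl
  obtain ⟨w, w', hw, hw', h0, h1⟩ := exists_dirichlet_solution_of_monotone hk a b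
    (G := fun x y => F x (c x y)) (lo := fun x => F x (wl (p x))) (hi := fun x => F x (wu (p x)))
    (hFcont continuous_fst ((hL.comp continuous_fst).max
      ((hU.comp continuous_fst).min continuous_snd)))
    (fun x y z hyz => hF x (hcl x y) (max_le_max le_rfl (min_le_min le_rfl hyz)) (hcu x z))
    (hFcont continuous_id hL) (hFcont continuous_id hU) hlo hhi
  have hk2 : 0 < k ^ 2 := by positivity
  have hwl : ∀ x ∈ Icc (0 : ℝ) 1, 0 ≤ w x - wl x := by
    refine nonneg_of_second_deriv_le hk2 (fun x hx => (hw x hx).sub (hwl1 x hx))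
      (fun x hx => (hw' x hx).sub (hwl2 x hx)) (fun x hx => ?_) (by linarith) (by linarith)
    have h₁ := hlo x (w x)
    have h₂ := hlower x hx
    simp only [F, hpid x hx] at h₁ ⊢
    linarith
  have hwu : ∀ x ∈ Icc (0 : ℝ) 1, 0 ≤ wu x - w x := by
    refine nonneg_of_second_deriv_le hk2 (fun x hx => (hwu1 x hx).sub (hw x hx))
      (fun x hx => (hwu2 x hx).sub (hw' x hx)) (fun x hx => ?_) (by linarith) (by linarith)
    have h₁ := hhi x (w x)
    have h₂ := hupper x hx
    simp only [F, hpid x hx] at h₁ ⊢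
    linarith
  refine ⟨w, w', hw, fun x hx => (hw' x hx).congr_deriv ?_, h0, h1,
    fun x hx => ⟨sub_nonneg.1 (hwl x hx), sub_nonneg.1 (hwu x hx)⟩⟩
  have hc : c x (w x) = w x := by
    simp only [c, hpid x hx]
    rw [min_eq_right (sub_nonneg.1 (hwu x hx)), max_eq_right (sub_nonneg.1 (hwl x hx))]
  simp only [F, hc, hpid x hx]
  ring
end
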